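/- Korn's inequality with zero boundary values: let n ≥ 2 and 1 < p < 2. Then there exists a constant c = c(n,p) > 0 such that for every ball B_ρ(x₀) ⊂ ℝⁿ and every smooth compactly supported vector field u ∈ C_c^∞(B_ρ(x₀), ℝⁿ) one has ∫_{B_ρ(x₀)} |Du(x)|^p dx ≤ c ∫_{B_ρ(x₀)} |𝓔u(x)|^p dx. -/

import Mathlib

open MeasureTheory Metric

/-- The Jacobian matrix `Du(x) ∈ ℝ^{n×n}` of a vector field `u : ℝⁿ → ℝⁿ`,
with entries `(Du(x))_{ij} = ∂u_i/∂x_j (x)`. -/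
noncomputable def jacobian {n : ℕ} (u : EuclideanSpace ℝ (Fin n) → EuclideanSpace ℝ (Fin n))
    (x : EuclideanSpace ℝ (Fin n)) : Matrix (Fin n) (Fin n) ℝ :=
  fun i j => fderiv ℝ u x (EuclideanSpace.single j 1) i

/-- The symmetric part `𝓔u(x) = (Du(x) + Du(x)ᵀ)/2` of the gradient. -/
noncomputable def symGrad {n : ℕ} (u : EuclideanSpace ℝ (Fin n) → EuclideanSpace ℝ (Fin n))
    (x : EuclideanSpace ℝ (Fin n)) : Matrix (Fin n) (Fin n) ℝ :=
  fun i j => (jacobian u x i j + jacobian u x j i) / 2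

/-- The Frobenius norm of a real `n × n` matrix. -/
noncomputable def frob {n : ℕ} (M : Matrix (Fin n) (Fin n) ℝ) : ℝ :=
  Real.sqrt (∑ i, ∑ j, M i j ^ 2)

/-- The terms of indefinite sign in the second derivative of `Y N ^ α`. Here `B`, `B₁`, `B₂`
stand for `N ^ α`, `N ^ (α - 1)`, `N ^ (α - 2)`. -/
theorem bellman_cross_terms {α Y N N₁ M B B₁ B₂ y η : ℝ} (hα0 : 0 ≤ α) (hα1 : α ≤ 1)
    (hY : 0 ≤ Y) (hy : y ^ 2 ≤ Y) (hN : 0 ≤ N) (hM : 0 ≤ M) (hB₂ : 0 ≤ B₂)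
    (h₂₁ : B₂ * N = B₁) (h₁₀ : B₁ * N = B) (hZ : Y * B₁ ≤ 1) (hN₁ : N₁ ^ 2 ≤ 2 * N * M) :
    -(B * η ^ 2 + 8 * M) ≤ 2 * (2 * y * η) * (N₁ * α * B₁) ∧
      -(2 * M) ≤ Y * (N₁ * α * (N₁ * (α - 1) * B₂)) := by
  have hB₁ : 0 ≤ B₁ := by rw [← h₂₁]; positivity
  have hB : 0 ≤ B := by rw [← h₁₀]; positivity
  constructor
  · have hα2 : α ^ 2 ≤ 1 := pow_le_one₀ hα0 hα1
    have hsq : (2 * (2 * y * η) * (N₁ * α * B₁)) ^ 2 ≤ 32 * (B * η ^ 2) * M := by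
      calc (2 * (2 * y * η) * (N₁ * α * B₁)) ^ 2
          = 16 * η ^ 2 * α ^ 2 * B₁ ^ 2 * (y ^ 2 * N₁ ^ 2) := by ring
        _ ≤ 16 * η ^ 2 * 1 * B₁ ^ 2 * (Y * (2 * N * M)) := by gcongr
        _ = 32 * η ^ 2 * (Y * B₁) * (B₁ * N) * M := by ring
        _ ≤ 32 * η ^ 2 * 1 * (B₁ * N) * M := by gcongr
        _ = _ := by rw [h₁₀]; ring
    have hU : 0 ≤ B * η ^ 2 := by positivity
    generalize 2 * (2 * y * η) * (N₁ * α * B₁) = W at *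
    generalize B * η ^ 2 = U at *
    refine (abs_le.1 (abs_le_of_sq_le_sq ?_ (by positivity))).1
    nlinarith [sq_nonneg (U - 8 * M)]
  · have h2 : Y * (B₂ * N₁ ^ 2) ≤ 2 * M := by
      calc Y * (B₂ * N₁ ^ 2) ≤ Y * (B₂ * (2 * N * M)) := by gcongr
        _ = (Y * (B₂ * N)) * (2 * M) := by ring
        _ ≤ 1 * (2 * M) := by rw [h₂₁]; gcongr
        _ = _ := by ring
    have h3 : 0 ≤ Y * (B₂ * N₁ ^ 2) := by positivity
    have h4 : Y * (N₁ * α * (N₁ * (α - 1) * B₂)) =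
      -((α * (1 - α)) * (Y * (B₂ * N₁ ^ 2))) := by ring
    have h5 : α * (1 - α) ≤ 1 := by nlinarith
    rw [h4, neg_le_neg_iff]
    calc _ ≤ 1 * (Y * (B₂ * N₁ ^ 2)) := by gcongr
      _ ≤ _ := by linarith

/-- Bound for the derivative of `N = X ^ (p / 2) + Y ^ (q / 2)` along a line. -/
theorem bellman_first_derivative_sq_le {p q X Y x y ξ η : ℝ} (hX : 0 < X) (hY : 0 < Y)
    (hx : x ^ 2 ≤ X) (hy : y ^ 2 ≤ Y) :
    (2 * x * ξ * (p / 2) * X ^ (p / 2 - 1) + 2 * y * η * (q / 2) * Y ^ (q / 2 - 1)) ^ 2 ≤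
      2 * (X ^ (p / 2) + Y ^ (q / 2)) *
        (p ^ 2 * (X ^ (p / 2 - 1) * ξ ^ 2) + q ^ 2 * (Y ^ (q / 2 - 1) * η ^ 2)) := by
  have aux : ∀ {r X Y x ξ : ℝ}, 0 < X → x ^ 2 ≤ X → 0 ≤ Y →
      (2 * x * ξ * (r / 2) * X ^ (r / 2 - 1)) ^ 2 ≤
        (X ^ (r / 2) + Y) * (r ^ 2 * (X ^ (r / 2 - 1) * ξ ^ 2)) := by
    intro r X Y x ξ hX hx hY
    have hXX : X ^ (r / 2 - 1) * X = X ^ (r / 2) := by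
      rw [← Real.rpow_add_one hX.ne']; congr 1; ring
    have hX1 : 0 < X ^ (r / 2 - 1) := Real.rpow_pos_of_pos hX _
    calc (2 * x * ξ * (r / 2) * X ^ (r / 2 - 1)) ^ 2
        = r ^ 2 * (X ^ (r / 2 - 1) * ξ ^ 2) * (X ^ (r / 2 - 1) * x ^ 2) := by ring
      _ ≤ r ^ 2 * (X ^ (r / 2 - 1) * ξ ^ 2) * (X ^ (r / 2 - 1) * X) := by gcongr
      _ ≤ r ^ 2 * (X ^ (r / 2 - 1) * ξ ^ 2) * (X ^ (r / 2) + Y) := by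
          rw [hXX]; gcongr; linarith
      _ = _ := by ring
  have h1 := aux (r := p) (ξ := ξ) hX hx (Real.rpow_pos_of_pos hY (q / 2)).le
  have h2 := aux (r := q) (ξ := η) hY hy (Real.rpow_pos_of_pos hX (p / 2)).le
  refine add_sq_le.trans ?_
  linarith

/-- Second order expansion along a line of the function
`N + δ Y N ^ α` with `N = X ^ (p / 2) + Y ^ (q / 2)`, bounded from below. -/
theorem bellman_hessian_bound {p q α δ X Y N x y ξ η : ℝ} (hp₁ : 1 < p) (hp₂ : p < 2)
    (hq : q = p / (p - 1)) (hα : α = (2 - p) / p) (hδ : δ = (p - 1) / (20 * q ^ 2))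
    (hX : 0 < X) (hY : 0 < Y) (hx : x ^ 2 ≤ X) (hy : y ^ 2 ≤ Y)
    (hN : N = X ^ (p / 2) + Y ^ (q / 2)) {N₁ N₂ : ℝ}
    (hN₁ : N₁ = 2 * x * ξ * (p / 2) * X ^ (p / 2 - 1) + 2 * y * η * (q / 2) * Y ^ (q / 2 - 1))
    (hN₂ : p * (p - 1) * (X ^ (p / 2 - 1) * ξ ^ 2) + q * (Y ^ (q / 2 - 1) * η ^ 2) ≤ N₂) :
    δ * ((N ^ α)⁻¹ * ξ ^ 2 + N ^ α * η ^ 2) ≤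
      N₂ + δ * (2 * η ^ 2 * N ^ α + 2 * (2 * y * η) * (N₁ * α * N ^ (α - 1)) +
        Y * (N₂ * α * N ^ (α - 1) + N₁ * α * (N₁ * (α - 1) * N ^ (α - 1 - 1)))) := by
  have hp0 : 0 < p := by linarith
  have hp1 : 0 < p - 1 := by linarith
  have hq2 : 2 < q := by rw [hq, lt_div_iff₀ hp1]; linarith
  have hα0 : 0 < α := by rw [hα]; apply div_pos <;> linarith
  have hα1 : α < 1 := by rw [hα, div_lt_one hp0]; linarith
  have hXp : 0 < X ^ (p / 2) := Real.rpow_pos_of_pos hX _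
  have hYp : 0 < Y ^ (q / 2) := Real.rpow_pos_of_pos hY _
  have hNpos : 0 < N := by rw [hN]; positivity
  have hδ0 : 0 < δ := by rw [hδ]; positivity
  have hX1 : 0 < X ^ (p / 2 - 1) := Real.rpow_pos_of_pos hX _
  have hY1 : 0 < Y ^ (q / 2 - 1) := Real.rpow_pos_of_pos hY _
  have hXN : X ^ (p / 2) ≤ N := by rw [hN]; linarith
  have hYN : Y ^ (q / 2) ≤ N := by rw [hN]; linarith
  have hN₁sq := bellman_first_derivative_sq_le (p := p) (q := q) (ξ := ξ) (η := η) hX hY hx hy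
  rw [← hN₁, ← hN] at hN₁sq
  have hB : 0 < N ^ α := Real.rpow_pos_of_pos hNpos _
  have hB₁ : 0 < N ^ (α - 1) := Real.rpow_pos_of_pos hNpos _
  have h₂₁ : N ^ (α - 1 - 1) * N = N ^ (α - 1) := by
    rw [← Real.rpow_add_one hNpos.ne']; congr 1; ring
  have h₁₀ : N ^ (α - 1) * N = N ^ α := by
    rw [← Real.rpow_add_one hNpos.ne']; congr 1; ring
  have hB₂ : 0 < N ^ (α - 1 - 1) := Real.rpow_pos_of_pos hNpos _
  have hZ1 : Y * N ^ (α - 1) ≤ 1 := by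
    have : Y ≤ N ^ (2 / q) := by
      calc Y = (Y ^ (q / 2)) ^ (2 / q) := by
            rw [← Real.rpow_mul hY.le]
            have : q / 2 * (2 / q) = 1 := by field_simp
            rw [this, Real.rpow_one]
        _ ≤ N ^ (2 / q) := by
            apply Real.rpow_le_rpow hYp.le hYN
            positivity
    have h2 : N ^ (2 / q) * N ^ (α - 1) = 1 := by
      rw [← Real.rpow_add hNpos]
      have : 2 / q + (α - 1) = 0 := by
        rw [hq, hα]; field_simp; ring
      rw [this, Real.rpow_zero]
    calc _ ≤ N ^ (2 / q) * N ^ (α - 1) := mul_le_mul_of_nonneg_right this hB₁.le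
      _ = 1 := h2
  have haN : (N ^ α)⁻¹ ≤ X ^ (p / 2 - 1) := by
    have h1 : X ^ (p / 2 - 1) = ((X ^ (p / 2)) ^ α)⁻¹ := by
      rw [← Real.rpow_mul hX.le, ← Real.rpow_neg hX.le]
      congr 1
      rw [hα]; field_simp; ring
    rw [h1]
    gcongr
  have hδp : δ ≤ (p - 1) / 2 := by
    rw [hδ]
    apply div_le_div_of_nonneg_left hp1.le (by norm_num)
    nlinarith
  have hpq : p ^ 2 ≤ q ^ 2 := by gcongr; linarith
  have hδq : 10 * δ * q ^ 2 = (p - 1) / 2 := by rw [hδ]; field_simp; norm_num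
  obtain ⟨hW, hR⟩ := bellman_cross_terms (η := η) hα0.le hα1.le hY.le hy hNpos.le
    (by positivity) hB₂.le h₂₁ h₁₀ hZ1 hN₁sq
  have hN₂0 : 0 ≤ N₂ := le_trans (by positivity) hN₂
  have hpos : 0 ≤ Y * (N₂ * α * N ^ (α - 1)) := by positivity
  have ha0 : 0 ≤ X ^ (p / 2 - 1) * ξ ^ 2 := by positivity
  have hb0 : 0 ≤ Y ^ (q / 2 - 1) * η ^ 2 := by positivity
  have haN' : (N ^ α)⁻¹ * ξ ^ 2 ≤ X ^ (p / 2 - 1) * ξ ^ 2 := by gcongr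
  clear hN hN₁ hN₁sq hXN hYN haN hZ1
  rw [mul_add Y]
  generalize X ^ (p / 2 - 1) * ξ ^ 2 = a at *
  generalize Y ^ (q / 2 - 1) * η ^ 2 = b at *
  generalize Y * (N₂ * α * N ^ (α - 1)) = T at *
  generalize Y * (N₁ * α * (N₁ * (α - 1) * N ^ (α - 1 - 1))) = R at *
  generalize 2 * (2 * y * η) * (N₁ * α * N ^ (α - 1)) = W at *
  generalize (N ^ α)⁻¹ * ξ ^ 2 = a' at *
  have hU : 2 * η ^ 2 * N ^ α = 2 * (N ^ α * η ^ 2) := by ring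
  rw [hU]
  generalize N ^ α * η ^ 2 = U at *
  have hM : p ^ 2 * a + q ^ 2 * b ≤ q ^ 2 * (a + b) := by
    rw [mul_add]; gcongr
  have hδM : 10 * δ * (p ^ 2 * a + q ^ 2 * b) ≤ (p - 1) / 2 * (a + b) := by
    rw [← hδq, mul_assoc _ (q ^ 2)]
    gcongr
  have hfin : (p - 1) * (a + b) ≤ N₂ := by
    refine le_trans ?_ hN₂
    have : (p - 1) * a ≤ p * (p - 1) * a := by
      gcongr; nlinarith
    have : (p - 1) * b ≤ q * b := by gcongr; linarith
    linarith
  have e1 : δ * (U - 10 * (p ^ 2 * a + q ^ 2 * b)) ≤ δ * (2 * U + W + (T + R)) := by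
    gcongr; linarith
  have e2 : δ * a' ≤ (p - 1) / 2 * a :=
    (mul_le_mul_of_nonneg_left haN' hδ0.le).trans (mul_le_mul_of_nonneg_right hδp ha0)
  have e3 : 0 ≤ (p - 1) / 2 * b := by positivity
  linarith

/-- Lower bound for the second derivative of `t ↦ (t ^ 2 + ε) ^ r`. -/
theorem second_deriv_sq_add_rpow_bound {r x X ξ : ℝ} (hX : 0 < X) (hx : x ^ 2 ≤ X)
    (hr : 0 < r) :
    2 * r * min 1 (2 * r - 1) * (X ^ (r - 1) * ξ ^ 2) ≤
      2 * ξ * ξ * r * X ^ (r - 1) +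
        2 * x * ξ * r * (2 * x * ξ * (r - 1) * X ^ (r - 1 - 1)) := by
  have h1 : X ^ (r - 1 - 1) * X = X ^ (r - 1) := by
    rw [← Real.rpow_add_one hX.ne']; congr 1; ring
  have hX2 : 0 < X ^ (r - 1 - 1) := Real.rpow_pos_of_pos hX _
  rw [← h1]
  have : 2 * ξ * ξ * r * (X ^ (r - 1 - 1) * X) +
        2 * x * ξ * r * (2 * x * ξ * (r - 1) * X ^ (r - 1 - 1)) =
      2 * r * (X ^ (r - 1 - 1) * ξ ^ 2) * (X + 2 * (r - 1) * x ^ 2) := by ring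
  rw [this]
  have : 2 * r * min 1 (2 * r - 1) * (X ^ (r - 1 - 1) * X * ξ ^ 2) =
    2 * r * (X ^ (r - 1 - 1) * ξ ^ 2) * (min 1 (2 * r - 1) * X) := by ring
  rw [this]
  gcongr
  rcases le_total r 1 with h | h
  · have := min_le_right (1 : ℝ) (2 * r - 1)
    nlinarith
  · have := min_le_left (1 : ℝ) (2 * r - 1)
    nlinarith [sq_nonneg x]

set_option maxHeartbeats 1000000 in
theorem bellman_function {p q : ℝ} (hp₁ : 1 < p) (hp₂ : p < 2) (hq : q = p / (p - 1)) :
    ∃ κ > 0, ∀ ε > 0, ∃ Φ : ℝ × ℝ → ℝ, ContDiff ℝ 2 Φ ∧ (∀ z, Φ 0 ≤ Φ z) ∧ 0 ≤ Φ 0 ∧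
      (∀ z, Φ z ≤ 2 * ((z.1 ^ 2 + ε) ^ (p / 2) + (z.2 ^ 2 + ε) ^ (q / 2))) ∧
      ∀ z, ∃ A > 0, ∀ d : ℝ × ℝ,
        κ * (A⁻¹ * d.1 ^ 2 + A * d.2 ^ 2) ≤ fderiv ℝ (fderiv ℝ Φ) z d d := by
  have hp0 : 0 < p := by linarith
  have hp1 : 0 < p - 1 := by linarith
  have hq2 : 2 < q := by rw [hq, lt_div_iff₀ hp1]; linarith
  obtain ⟨δ, hδ⟩ : ∃ δ, δ = (p - 1) / (20 * q ^ 2) := ⟨_, rfl⟩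
  obtain ⟨α, hα⟩ : ∃ α, α = (2 - p) / p := ⟨_, rfl⟩
  have hα0 : 0 < α := by rw [hα]; apply div_pos <;> linarith
  have hδ0 : 0 < δ := by rw [hδ]; positivity
  refine ⟨δ, hδ0, fun ε hε => ?_⟩
  let N : ℝ × ℝ → ℝ := fun z => (z.1 ^ 2 + ε) ^ (p / 2) + (z.2 ^ 2 + ε) ^ (q / 2)
  let Φ : ℝ × ℝ → ℝ := fun z => N z + δ * ((z.2 ^ 2 + ε) * N z ^ α)
  have hX : ∀ t : ℝ, 0 < t ^ 2 + ε := fun t => by positivity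
  have hN : ∀ z, 0 < N z := fun z =>
    add_pos (Real.rpow_pos_of_pos (hX _) _) (Real.rpow_pos_of_pos (hX _) _)
  have hNc : ContDiff ℝ 2 N := by
    apply ContDiff.add
    · exact ((contDiff_fst.pow 2).add contDiff_const).rpow_const_of_ne fun z => (hX _).ne'
    · exact ((contDiff_snd.pow 2).add contDiff_const).rpow_const_of_ne fun z => (hX _).ne'
  have hΦc : ContDiff ℝ 2 Φ := by
    apply hNc.add
    apply contDiff_const.mul
    exact ((contDiff_snd.pow 2).add contDiff_const).mul (hNc.rpow_const_of_ne fun z => (hN z).ne')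
  have hN0 : ∀ z, N 0 ≤ N z := fun z => by
    simp only [N, Prod.fst_zero, Prod.snd_zero]
    gcongr ?_ ^ (p / 2) + ?_ ^ (q / 2) <;> nlinarith [sq_nonneg z.1, sq_nonneg z.2]
  refine ⟨Φ, hΦc, fun z => ?_, ?_, fun z => ?_, fun z => ?_⟩
  · have h1 := hN0 z
    have h2 : (0 : ℝ) ^ 2 + ε ≤ z.2 ^ 2 + ε := by nlinarith [sq_nonneg z.2]
    have := (hN 0).le
    change N 0 + δ * (((0 : ℝ) ^ 2 + ε) * N 0 ^ α) ≤ N z + δ * ((z.2 ^ 2 + ε) * N z ^ α)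
    gcongr
  · have := Real.rpow_pos_of_pos (hN 0) α
    have h3 := hN 0
    change 0 ≤ N 0 + δ * (((0 : ℝ) ^ 2 + ε) * N 0 ^ α)
    positivity
  · have hYN : z.2 ^ 2 + ε ≤ N z ^ (2 / q) := by
      calc z.2 ^ 2 + ε = ((z.2 ^ 2 + ε) ^ (q / 2)) ^ (2 / q) := by
            rw [← Real.rpow_mul (hX _).le]
            have : q / 2 * (2 / q) = 1 := by field_simp
            rw [this, Real.rpow_one]
        _ ≤ N z ^ (2 / q) := by
            apply Real.rpow_le_rpow (Real.rpow_nonneg (hX _).le _)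
            · exact le_add_of_nonneg_left (Real.rpow_nonneg (hX _).le _)
            · positivity
    have h2 : N z ^ (2 / q) * N z ^ α = N z := by
      rw [← Real.rpow_add (hN z)]
      have : 2 / q + α = 1 := by
        rw [hq, hα]; field_simp; ring
      rw [this, Real.rpow_one]
    have h3 : (z.2 ^ 2 + ε) * N z ^ α ≤ N z := by
      calc _ ≤ N z ^ (2 / q) * N z ^ α :=
            mul_le_mul_of_nonneg_right hYN (Real.rpow_nonneg (hN z).le _)
        _ = _ := h2
    have hδ1 : δ ≤ 1 := by
      rw [hδ, div_le_one (by positivity)]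
      nlinarith
    have := hN z
    change N z + δ * ((z.2 ^ 2 + ε) * N z ^ α) ≤ 2 * N z
    nlinarith [mul_le_mul_of_nonneg_left h3 hδ0.le, mul_le_mul_of_nonneg_right hδ1 this.le]
  · refine ⟨N z ^ α, Real.rpow_pos_of_pos (hN z) _, fun d => ?_⟩
    -- the function along the line `z + r d`
    have hline : ∀ r : ℝ, HasDerivAt (fun r : ℝ => z + r • d) d r := fun r => by
      simpa using ((hasDerivAt_id r).smul_const d).const_add z
    have hd1 : Differentiable ℝ Φ := hΦc.differentiable (by norm_num)
    have hd2 : Differentiable ℝ (fderiv ℝ Φ) :=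
      (hΦc.fderiv_right (m := 1) (by norm_num)).differentiable (by norm_num)
    have A1 : ∀ r : ℝ, HasDerivAt (fun r : ℝ => Φ (z + r • d)) (fderiv ℝ Φ (z + r • d) d) r :=
      fun r => (hd1 _).hasFDerivAt.comp_hasDerivAt r (hline r)
    have A2 : HasDerivAt (fun r : ℝ => fderiv ℝ Φ (z + r • d) d)
        (fderiv ℝ (fderiv ℝ Φ) z d d) 0 := by
      have := ((hd2 (z + (0 : ℝ) • d)).hasFDerivAt.comp_hasDerivAt (0 : ℝ) (hline 0)).clm_apply
        (hasDerivAt_const (0 : ℝ) d)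
      simpa using this
    let x : ℝ → ℝ := fun r => z.1 + r * d.1
    let y : ℝ → ℝ := fun r => z.2 + r * d.2
    have hlin : ∀ a b r : ℝ, HasDerivAt (fun r : ℝ => a + r * b) b r := fun a b r => by
      simpa using ((hasDerivAt_id r).mul_const b).const_add a
    have hx : ∀ r, HasDerivAt x d.1 r := hlin _ _
    have hy : ∀ r, HasDerivAt y d.2 r := hlin _ _
    have hXd : ∀ r, HasDerivAt (fun r => x r ^ 2 + ε) (2 * x r * d.1) r := fun r => by
      simpa using ((hx r).pow 2).add_const ε
    have hYd : ∀ r, HasDerivAt (fun r => y r ^ 2 + ε) (2 * y r * d.2) r := fun r => by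
      simpa using ((hy r).pow 2).add_const ε
    let n : ℝ → ℝ := fun r => (x r ^ 2 + ε) ^ (p / 2) + (y r ^ 2 + ε) ^ (q / 2)
    let n₁ : ℝ → ℝ := fun r => 2 * x r * d.1 * (p / 2) * (x r ^ 2 + ε) ^ (p / 2 - 1) +
      2 * y r * d.2 * (q / 2) * (y r ^ 2 + ε) ^ (q / 2 - 1)
    have hn : ∀ r, HasDerivAt n (n₁ r) r := fun r =>
      ((hXd r).rpow_const (Or.inl (hX _).ne')).add ((hYd r).rpow_const (Or.inl (hX _).ne'))
    have hn0 : ∀ r, n r ≠ 0 := fun r => (hN (x r, y r)).ne'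
    have hXd1 : HasDerivAt (fun r => 2 * x r * d.1 * (p / 2)) (2 * d.1 * d.1 * (p / 2)) 0 :=
      (((hx 0).const_mul 2).mul_const _).mul_const _
    have hYd1 : HasDerivAt (fun r => 2 * y r * d.2 * (q / 2)) (2 * d.2 * d.2 * (q / 2)) 0 :=
      (((hy 0).const_mul 2).mul_const _).mul_const _
    have hn₁ : HasDerivAt n₁ _ 0 :=
      (hXd1.mul ((hXd 0).rpow_const (p := p / 2 - 1) (Or.inl (hX _).ne'))).add
      (hYd1.mul ((hYd 0).rpow_const (p := q / 2 - 1) (Or.inl (hX _).ne')))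
    have B1 : ∀ r, HasDerivAt (fun r : ℝ => Φ (z + r • d))
        (n₁ r + δ * (2 * y r * d.2 * n r ^ α +
          (y r ^ 2 + ε) * (n₁ r * α * n r ^ (α - 1)))) r := fun r =>
      (hn r).add (((hYd r).mul ((hn r).rpow_const (Or.inl (hn0 r)))).const_mul δ)
    have C1 : HasDerivAt (fun r => 2 * y r * d.2 * n r ^ α) _ 0 :=
      (((hy 0).const_mul 2).mul_const d.2).mul ((hn 0).rpow_const (p := α) (Or.inl (hn0 0)))
    have C2 : HasDerivAt (fun r => n₁ r * α * n r ^ (α - 1)) _ 0 :=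
      (hn₁.mul_const α).mul ((hn 0).rpow_const (p := α - 1) (Or.inl (hn0 0)))
    have C3 : HasDerivAt (fun r => (y r ^ 2 + ε) * (n₁ r * α * n r ^ (α - 1))) _ 0 :=
      (hYd 0).mul C2
    have B2 : HasDerivAt (fun r => n₁ r + δ * (2 * y r * d.2 * n r ^ α +
        (y r ^ 2 + ε) * (n₁ r * α * n r ^ (α - 1)))) _ 0 :=
      hn₁.add ((C1.add C3).const_mul δ)
    have hfun : (fun r : ℝ => fderiv ℝ Φ (z + r • d) d) = fun r =>
        (n₁ r + δ * (2 * y r * d.2 * n r ^ α +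
          (y r ^ 2 + ε) * (n₁ r * α * n r ^ (α - 1)))) :=
      funext fun r => (A1 r).unique (B1 r)
    rw [hfun] at A2
    have hval := A2.unique B2
    rw [hval]
    have hx0 : x 0 = z.1 := by simp [x]
    have hy0 : y 0 = z.2 := by simp [y]
    have hn00 : n 0 = N z := by simp only [n, N, hx0, hy0]
    have hle1 : z.1 ^ 2 ≤ z.1 ^ 2 + ε := by linarith
    have hle2 : z.2 ^ 2 ≤ z.2 ^ 2 + ε := by linarith
    have hs1 := second_deriv_sq_add_rpow_bound (ξ := d.1) (hX z.1) hle1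
      (show 0 < p / 2 by positivity)
    have hs2 := second_deriv_sq_add_rpow_bound (ξ := d.2) (hX z.2) hle2
      (show 0 < q / 2 by positivity)
    rw [min_eq_right (by linarith)] at hs1
    rw [min_eq_left (by linarith)] at hs2
    have hs : p * (p - 1) * ((z.1 ^ 2 + ε) ^ (p / 2 - 1) * d.1 ^ 2) +
        q * ((z.2 ^ 2 + ε) ^ (q / 2 - 1) * d.2 ^ 2) ≤ _ :=
      le_trans (le_of_eq (by ring)) (add_le_add hs1 hs2)
    have hfinal := bellman_hessian_bound (ξ := d.1) (η := d.2) hp₁ hp₂ hq hα hδ (hX z.1)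
      (hX z.2) hle1 hle2 (N := N z) rfl rfl hs
    refine hfinal.trans (le_of_eq ?_)
    simp only [n₁, hx0, hy0, hn00]
    generalize (z.1 ^ 2 + ε) ^ (p / 2 - 1 - 1) = a₂
    generalize (z.1 ^ 2 + ε) ^ (p / 2 - 1) = a₁
    generalize (z.2 ^ 2 + ε) ^ (q / 2 - 1 - 1) = b₂
    generalize (z.2 ^ 2 + ε) ^ (q / 2 - 1) = b₁
    generalize N z ^ (α - 1 - 1) = c₂
    generalize N z ^ (α - 1) = c₁
    generalize N z ^ α = c₀
    generalize z.2 ^ 2 + ε = Y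
    ring

section GaussianAverage

variable {V : Type*} [NormedAddCommGroup V] [InnerProductSpace ℝ V] [FiniteDimensional ℝ V]
  [MeasurableSpace V] [BorelSpace V] {E : Type*} [NormedAddCommGroup E] [NormedSpace ℝ E]

theorem one_add_pow_mul_exp_le (k : ℕ) :
    ∃ C, ∀ t : ℝ, 0 ≤ t → (1 + t) ^ k * Real.exp (-t ^ 2 / 2) ≤ C := by
  refine ⟨4 ^ k * k.factorial * Real.exp (1 / 2), fun t ht => ?_⟩
  have h1 : (1 + t) ^ k ≤ 4 ^ k * ((1 + t ^ 2) / 2) ^ k := by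
    rw [← mul_pow]
    gcongr
    nlinarith [sq_nonneg (t - 1)]
  have h2 := Real.pow_div_factorial_le_exp ((1 + t ^ 2) / 2) (by positivity) k
  rw [div_le_iff₀ (by positivity)] at h2
  have h3 : Real.exp ((1 + t ^ 2) / 2) * Real.exp (-t ^ 2 / 2) = Real.exp (1 / 2) := by
    rw [← Real.exp_add]; congr 1; ring
  calc (1 + t) ^ k * Real.exp (-t ^ 2 / 2)
      ≤ 4 ^ k * (Real.exp ((1 + t ^ 2) / 2) * k.factorial) * Real.exp (-t ^ 2 / 2) := by
        gcongr
        exact h1.trans (by gcongr)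
    _ = 4 ^ k * k.factorial * (Real.exp ((1 + t ^ 2) / 2) * Real.exp (-t ^ 2 / 2)) := by ring
    _ = _ := by rw [h3]

/-- An integrable weight with polynomial decay. -/
noncomputable def polyDecay (x : V) : ℝ := ((1 + ‖x‖) ^ (Module.finrank ℝ V + 1))⁻¹

theorem integrable_polyDecay : Integrable (polyDecay : V → ℝ) := by
  have h := integrable_one_add_norm (E := V) (μ := volume)
    (r := ((Module.finrank ℝ V + 1 : ℕ) : ℝ)) (by push_cast; linarith)
  refine h.congr (Filter.Eventually.of_forall fun x => ?_)
  simp only [polyDecay]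
  rw [Real.rpow_neg (by positivity), Real.rpow_natCast]

theorem integrable_one_add_norm_pow_mul_exp (k : ℕ) :
    Integrable (fun z : V => (1 + ‖z‖) ^ k * Real.exp (-‖z‖ ^ 2 / 2)) := by
  obtain ⟨C, hC⟩ := one_add_pow_mul_exp_le (k + (Module.finrank ℝ V + 1))
  refine (integrable_polyDecay.const_mul C).mono'
    (by fun_prop) (Filter.Eventually.of_forall fun z => ?_)
  have h := hC ‖z‖ (norm_nonneg z)
  rw [Real.norm_of_nonneg (by positivity), polyDecay, ← div_eq_mul_inv, le_div_iff₀ (by positivity)]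
  calc _ = (1 + ‖z‖) ^ (k + (Module.finrank ℝ V + 1)) * Real.exp (-‖z‖ ^ 2 / 2) := by ring
    _ ≤ C := h

/-- The density of the standard Gaussian measure. -/
noncomputable def gaussWeight (z : V) : ℝ :=
  (∫ y : V, Real.exp (-‖y‖ ^ 2 / 2))⁻¹ * Real.exp (-‖z‖ ^ 2 / 2)

theorem integral_exp_neg_norm_sq_pos : 0 < ∫ y : V, Real.exp (-‖y‖ ^ 2 / 2) := by
  apply integral_exp_pos
  simpa using integrable_one_add_norm_pow_mul_exp (V := V) 0

theorem gaussWeight_nonneg (z : V) : 0 ≤ gaussWeight z :=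
  mul_nonneg (inv_nonneg.2 integral_exp_neg_norm_sq_pos.le) (Real.exp_pos _).le

theorem gaussWeight_le (z : V) : gaussWeight z ≤ gaussWeight (0 : V) := by
  have := integral_exp_neg_norm_sq_pos (V := V)
  unfold gaussWeight
  gcongr
  simp

@[fun_prop]
theorem continuous_gaussWeight : Continuous (gaussWeight : V → ℝ) := by
  unfold gaussWeight
  fun_prop

theorem integral_gaussWeight : ∫ z : V, gaussWeight z = 1 := by
  unfold gaussWeight
  rw [integral_const_mul, inv_mul_cancel₀ integral_exp_neg_norm_sq_pos.ne']

theorem integrable_one_add_norm_pow_mul_gaussWeight (k : ℕ) :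
    Integrable (fun z : V => (1 + ‖z‖) ^ k * gaussWeight z) := by
  refine ((integrable_one_add_norm_pow_mul_exp k).const_mul
    (∫ y : V, Real.exp (-‖y‖ ^ 2 / 2))⁻¹).congr (Filter.Eventually.of_forall fun z => ?_)
  simp only [gaussWeight]
  ring

theorem integrable_gaussWeight : Integrable (gaussWeight : V → ℝ) := by
  simpa using integrable_one_add_norm_pow_mul_gaussWeight (V := V) 0

theorem hasLineDerivAt_gaussWeight (z v : V) :
    HasLineDerivAt ℝ gaussWeight (-(inner ℝ v z * gaussWeight z)) z v := by
  have h1 : HasDerivAt (fun t : ℝ => ‖z + t • v‖ ^ 2) (2 * inner ℝ z v) 0 := by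
    have : HasDerivAt (fun t : ℝ => z + t • v) v 0 := by
      simpa using ((hasDerivAt_id (0 : ℝ)).smul_const v).const_add z
    simpa using this.norm_sq
  have h2 := ((h1.neg.div_const 2).exp).const_mul (∫ y : V, Real.exp (-‖y‖ ^ 2 / 2))⁻¹
  unfold HasLineDerivAt gaussWeight
  refine h2.congr_deriv ?_
  rw [real_inner_comm, Pi.neg_apply, zero_smul, add_zero]
  ring

/-- The average of `g` over a Gaussian of standard deviation `|s|` centred at `x`. -/
noncomputable def gaussAvg (g : V → E) (s : ℝ) (x : V) : E :=
  ∫ z, gaussWeight z • g (x + s • z)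

theorem gaussAvg_zero [CompleteSpace E] (g : V → E) (x : V) : gaussAvg g 0 x = g x := by
  simp [gaussAvg, integral_smul_const, integral_gaussWeight]

theorem continuous_gaussAvg {g : V → E} (hg : Continuous g) (hs : HasCompactSupport g) (s : ℝ) :
    Continuous (gaussAvg g s) := by
  obtain ⟨M, hM⟩ := hs.exists_bound_of_continuous hg
  refine continuous_of_dominated (bound := fun z => gaussWeight z * M)
    (fun x => by fun_prop) (fun x => Filter.Eventually.of_forall fun z => ?_)
    (integrable_gaussWeight.mul_const M) (Filter.Eventually.of_forall fun z => by fun_prop)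
  rw [norm_smul, Real.norm_of_nonneg (gaussWeight_nonneg z)]
  exact mul_le_mul_of_nonneg_left (hM _) (gaussWeight_nonneg z)

theorem exists_norm_gaussAvg_le {g : V → E} (hg : Continuous g) (hs : HasCompactSupport g)
    (S : ℝ) : ∃ C, ∀ s, |s| ≤ S → ∀ x,
      ‖gaussAvg g s x‖ ≤ C * polyDecay x := by
  obtain ⟨m, hm⟩ : ∃ m, m = Module.finrank ℝ V + 1 := ⟨_, rfl⟩
  obtain ⟨M, hM⟩ : ∃ M, ∀ x, ‖(1 + ‖x‖) ^ m • g x‖ ≤ M :=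
    hs.smul_left.exists_bound_of_continuous (by fun_prop)
  have hM0 : 0 ≤ M := (norm_nonneg _).trans (hM 0)
  refine ⟨(1 + S) ^ m * M * ∫ z : V, (1 + ‖z‖) ^ m * gaussWeight z, fun s hsS x => ?_⟩
  rw [polyDecay, ← hm, ← div_eq_mul_inv, le_div_iff₀ (by positivity)]
  have hS : 0 ≤ S := (abs_nonneg s).trans hsS
  rw [← Real.norm_of_nonneg (show 0 ≤ (1 + ‖x‖) ^ m by positivity), mul_comm, ← norm_smul,
    gaussAvg, ← integral_smul, ← integral_const_mul]
  refine norm_integral_le_of_norm_le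
    ((integrable_one_add_norm_pow_mul_gaussWeight m).const_mul _)
    (Filter.Eventually.of_forall fun z => ?_)
  have h1 : 1 + ‖x‖ ≤ (1 + ‖x + s • z‖) * ((1 + S) * (1 + ‖z‖)) := by
    have h2 : ‖x‖ ≤ ‖x + s • z‖ + S * ‖z‖ := by
      calc ‖x‖ = ‖(x + s • z) - s • z‖ := by simp
        _ ≤ ‖x + s • z‖ + ‖s • z‖ := norm_sub_le _ _
        _ ≤ _ := by
          rw [norm_smul]
          gcongr
          exact hsS
    have h3 := norm_nonneg z
    have h4 := norm_nonneg (x + s • z)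
    have h5 := mul_nonneg hS h3
    have : 1 + S * ‖z‖ ≤ (1 + S) * (1 + ‖z‖) := by nlinarith
    nlinarith
  have hM' := hM (x + s • z)
  rw [norm_smul, Real.norm_of_nonneg (by positivity)] at hM'
  rw [norm_smul, norm_smul, Real.norm_of_nonneg (by positivity),
    Real.norm_of_nonneg (gaussWeight_nonneg z)]
  have hw := gaussWeight_nonneg z
  calc (1 + ‖x‖) ^ m * (gaussWeight z * ‖g (x + s • z)‖)
      ≤ ((1 + ‖x + s • z‖) * ((1 + S) * (1 + ‖z‖))) ^ m *
        (gaussWeight z * ‖g (x + s • z)‖) := by gcongr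
    _ = (1 + S) ^ m * ((1 + ‖x + s • z‖) ^ m * ‖g (x + s • z)‖) *
        ((1 + ‖z‖) ^ m * gaussWeight z) := by rw [mul_pow, mul_pow]; ring
    _ ≤ (1 + S) ^ m * M * ((1 + ‖z‖) ^ m * gaussWeight z) := by gcongr

theorem hasDerivAt_gaussAvg_line {g : V → E} (hg : ContDiff ℝ 1 g) (hs : HasCompactSupport g)
    (x v : V) (s b r : ℝ) :
    HasDerivAt (fun r : ℝ => gaussAvg g (s + r * b) (x + r • v))
      (∫ z, gaussWeight z • fderiv ℝ g (x + r • v + (s + r * b) • z) (v + b • z)) r := by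
  obtain ⟨M, hM⟩ := hs.exists_bound_of_continuous hg.continuous
  obtain ⟨D, hD⟩ := (hs.fderiv ℝ).exists_bound_of_continuous (hg.continuous_fderiv one_ne_zero)
  have hD0 : 0 ≤ D := (norm_nonneg _).trans (hD 0)
  have hc := hg.continuous
  have hc' := hg.continuous_fderiv one_ne_zero
  have hbd : Integrable (fun z : V => D * (‖v‖ + |b|) * ((1 + ‖z‖) ^ 1 * gaussWeight z)) :=
    (integrable_one_add_norm_pow_mul_gaussWeight 1).const_mul _
  refine (hasDerivAt_integral_of_dominated_loc_of_deriv_le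
    (F := fun r z => gaussWeight z • g (x + r • v + (s + r * b) • z))
    (F' := fun r z => gaussWeight z • fderiv ℝ g (x + r • v + (s + r * b) • z) (v + b • z))
    (s := Set.univ) Filter.univ_mem
    (Filter.Eventually.of_forall fun r => ?_) ?_ ?_
    (Filter.Eventually.of_forall fun z r _ => ?_) hbd
    (Filter.Eventually.of_forall fun z r _ => ?_)).2
  · exact Continuous.aestronglyMeasurable (by fun_prop)
  · exact integrable_gaussWeight.smul_bdd M
      (Continuous.aestronglyMeasurable (by fun_prop)) (Filter.Eventually.of_forall fun z => hM _)
  · exact Continuous.aestronglyMeasurable (by fun_prop)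
  · have hw := gaussWeight_nonneg z
    rw [norm_smul, Real.norm_of_nonneg hw]
    have h1 : ‖v + b • z‖ ≤ (‖v‖ + |b|) * (1 + ‖z‖) := by
      refine (norm_add_le _ _).trans ?_
      rw [norm_smul, Real.norm_eq_abs]
      nlinarith [norm_nonneg v, norm_nonneg z, abs_nonneg b,
        mul_nonneg (norm_nonneg v) (norm_nonneg z)]
    have h2 := (fderiv ℝ g (x + r • v + (s + r * b) • z)).le_of_opNorm_le (hD _) (v + b • z)
    calc _ ≤ gaussWeight z * (D * ((‖v‖ + |b|) * (1 + ‖z‖))) := by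
          gcongr
          exact h2.trans (by gcongr)
      _ = _ := by ring
  · have h1 : HasDerivAt (fun r : ℝ => x + r • v + (s + r * b) • z) (v + b • z) r := by
      have h2 : HasDerivAt (fun r : ℝ => x + r • v) v r := by
        simpa using ((hasDerivAt_id r).smul_const v).const_add x
      have h3 : HasDerivAt (fun r : ℝ => (s + r * b) • z) (b • z) r := by
        simpa using (((hasDerivAt_id r).mul_const b).const_add s).smul_const z
      exact h2.add h3
    exact ((hg.differentiable one_ne_zero _).hasFDerivAt.comp_hasDerivAt r h1).const_smul _

theorem hasLineDerivAt_gaussAvg {g : V → E} (hg : ContDiff ℝ 1 g) (hs : HasCompactSupport g)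
    (s : ℝ) (x v : V) :
    HasLineDerivAt ℝ (gaussAvg g s) (gaussAvg (fun y => fderiv ℝ g y v) s x) x v := by
  simpa [gaussAvg, HasLineDerivAt] using hasDerivAt_gaussAvg_line hg hs x v s 0 0

theorem integral_inner_mul_gaussWeight_smul {h : V → E} (hh : ContDiff ℝ 1 h)
    (hs : HasCompactSupport h) (s : ℝ) (x v : V) :
    ∫ z, (inner ℝ v z * gaussWeight z) • h (x + s • z) =
      s • gaussAvg (fun y => fderiv ℝ h y v) s x := by
  obtain ⟨M, hM⟩ := hs.exists_bound_of_continuous hh.continuous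
  obtain ⟨D, hD⟩ := (hs.fderiv_apply ℝ v).exists_bound_of_continuous
    ((hh.continuous_fderiv one_ne_zero).clm_apply continuous_const)
  have hc := hh.continuous
  have hc' := hh.continuous_fderiv one_ne_zero
  have hi : Integrable (fun z : V => inner ℝ v z * gaussWeight z) := by
    refine ((integrable_one_add_norm_pow_mul_gaussWeight 1).const_mul ‖v‖).mono'
      (Continuous.aestronglyMeasurable (by fun_prop)) (Filter.Eventually.of_forall fun z => ?_)
    have hw := gaussWeight_nonneg z
    rw [norm_mul, Real.norm_of_nonneg hw, pow_one, ← mul_assoc]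
    gcongr
    exact (norm_inner_le_norm v z).trans (by gcongr; linarith)
  have key := integral_bilinear_hasLineDerivAt_right_eq_neg_left_of_integrable
    (μ := (volume : Measure V)) (B := ContinuousLinearMap.lsmul ℝ ℝ) (f := gaussWeight)
    (f' := fun z => -(inner ℝ v z * gaussWeight z)) (g := fun z => h (x + s • z))
    (g' := fun z => s • fderiv ℝ h (x + s • z) v) (v := v) ?_ ?_ ?_
    (fun z _ => hasLineDerivAt_gaussWeight z v) (fun z _ => ?_)
  · simp only [ContinuousLinearMap.lsmul_apply, neg_smul, integral_neg, neg_neg] at key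
    rw [← key, gaussAvg, ← integral_smul]
    simp only [smul_comm s]
  · simp only [ContinuousLinearMap.lsmul_apply]
    exact hi.neg.smul_bdd M (Continuous.aestronglyMeasurable (by fun_prop))
      (Filter.Eventually.of_forall fun z => hM _)
  · simp only [ContinuousLinearMap.lsmul_apply]
    refine integrable_gaussWeight.smul_bdd (|s| * D)
      (Continuous.aestronglyMeasurable (by fun_prop)) (Filter.Eventually.of_forall fun z => ?_)
    rw [norm_smul, Real.norm_eq_abs]
    gcongr
    exact hD _
  · simp only [ContinuousLinearMap.lsmul_apply]
    exact integrable_gaussWeight.smul_bdd M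
      (Continuous.aestronglyMeasurable (by fun_prop)) (Filter.Eventually.of_forall fun z => hM _)
  · have h1 : HasDerivAt (fun t : ℝ => x + s • (z + t • v)) (s • v) 0 := by
      have : HasDerivAt (fun t : ℝ => z + t • v) v 0 := by
        simpa using ((hasDerivAt_id (0 : ℝ)).smul_const v).const_add z
      simpa using (this.const_smul s).const_add x
    have h2 := (hh.differentiable one_ne_zero
      (x + s • (z + (0 : ℝ) • v))).hasFDerivAt.comp_hasDerivAt (0 : ℝ) h1
    simpa [HasLineDerivAt, Function.comp_def] using h2

theorem hasDerivAt_gaussAvg {ι : Type*} [Fintype ι] (b : OrthonormalBasis ι ℝ V) {g : V → E}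
    (hg : ContDiff ℝ 2 g) (hs : HasCompactSupport g) (s : ℝ) (x : V) :
    HasDerivAt (fun s => gaussAvg g s x)
      (s • ∑ j, gaussAvg (fun y => fderiv ℝ (fun y => fderiv ℝ g y (b j)) y (b j)) s x) s := by
  have h := hasDerivAt_gaussAvg_line (hg.of_le one_le_two) hs x 0 0 1 s
  simp only [zero_add, mul_one, smul_zero, add_zero, one_smul] at h
  convert h using 1
  have hd : ∀ j, ContDiff ℝ 1 (fun y => fderiv ℝ g y (b j)) := fun j =>
    (hg.fderiv_right (m := 1) (by norm_num)).clm_apply contDiff_const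
  rw [Finset.smul_sum]
  simp only [← integral_inner_mul_gaussWeight_smul (hd _) (hs.fderiv_apply ℝ _)]
  rw [← integral_finsetSum]
  · refine integral_congr_ae (Filter.Eventually.of_forall fun z => ?_)
    simp only
    have hz : fderiv ℝ g (x + s • z) z =
        ∑ j, inner ℝ (b j) z • fderiv ℝ g (x + s • z) (b j) := by
      simp only [← map_smul, ← map_sum, b.sum_repr' z]
    rw [hz, Finset.smul_sum]
    simp only [smul_smul, mul_comm]
  · intro j _
    obtain ⟨D, hD⟩ := (hs.fderiv_apply ℝ (b j)).exists_bound_of_continuous (hd j).continuous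
    have hc := (hd j).continuous
    refine Integrable.smul_bdd (φ := fun z => inner ℝ (b j) z * gaussWeight z) ?_ D
      (Continuous.aestronglyMeasurable (by fun_prop))
      (Filter.Eventually.of_forall fun z => hD _)
    refine (integrable_one_add_norm_pow_mul_gaussWeight 1).mono'
      (Continuous.aestronglyMeasurable (by fun_prop)) (Filter.Eventually.of_forall fun z => ?_)
    have hw := gaussWeight_nonneg z
    rw [norm_mul, Real.norm_of_nonneg hw, pow_one]
    gcongr
    refine (norm_inner_le_norm (b j) z).trans ?_
    simp

end GaussianAverage

section Entropy

variable {V : Type*} [NormedAddCommGroup V] [InnerProductSpace ℝ V] [FiniteDimensional ℝ V]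
  [MeasurableSpace V] [BorelSpace V]

theorem integrable_of_norm_le_polyDecay {h : V → ℝ} (hh : AEStronglyMeasurable h) {C : ℝ}
    (hC : ∀ x, ‖h x‖ ≤ C * polyDecay x) : Integrable h :=
  (integrable_polyDecay.const_mul C).mono' hh (Filter.Eventually.of_forall hC)

theorem integral_eq_zero_of_hasLineDerivAt {h h' : V → ℝ} {v : V} (hh : Integrable h)
    (hh' : Integrable h') (hd : ∀ x, HasLineDerivAt ℝ h (h' x) x v) : ∫ x, h' x = 0 := by
  have key := integral_bilinear_hasLineDerivAt_right_eq_neg_left_of_integrable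
    (μ := (volume : Measure V)) (B := ContinuousLinearMap.mul ℝ ℝ) (f := fun _ : V => (1 : ℝ))
    (f' := fun _ => 0) (g := h) (g' := h') (v := v) (by simp) (by simpa using hh')
    (by simpa using hh) (fun z _ => hasDerivAt_const _ _) (fun z _ => hd z)
  simpa using key

variable {E : Type*} [NormedAddCommGroup E] [NormedSpace ℝ E]

theorem exists_norm_gaussAvg_le_const {g : V → E} (hg : Continuous g) (hs : HasCompactSupport g) :
    ∃ R, ∀ s x, ‖gaussAvg g s x‖ ≤ R := by
  obtain ⟨M, hM⟩ := hs.exists_bound_of_continuous hg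
  refine ⟨M, fun s x => ?_⟩
  have h := norm_integral_le_of_norm_le (f := fun z => gaussWeight z • g (x + s • z))
    (integrable_gaussWeight.mul_const M) (Filter.Eventually.of_forall fun z => by
      rw [norm_smul, Real.norm_of_nonneg (gaussWeight_nonneg z)]
      exact mul_le_mul_of_nonneg_left (hM _) (gaussWeight_nonneg z))
  rwa [integral_mul_const, integral_gaussWeight, one_mul] at h

theorem exists_norm_comp_gaussAvg_le [ProperSpace E] {F : Type*} [NormedAddCommGroup F]
    {g : V → E} (hg : Continuous g) (hs : HasCompactSupport g) {Ψ : E → F} (hΨ : Continuous Ψ) :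
    ∃ C, 0 ≤ C ∧ ∀ s x, ‖Ψ (gaussAvg g s x)‖ ≤ C := by
  obtain ⟨R, hR⟩ := exists_norm_gaussAvg_le_const hg hs
  obtain ⟨C, hC⟩ := (isCompact_closedBall (0 : E) R).exists_bound_of_continuousOn
    hΨ.continuousOn
  have h : ∀ s x, ‖Ψ (gaussAvg g s x)‖ ≤ C := fun s x => hC _ (by simpa using hR s x)
  exact ⟨C, (norm_nonneg _).trans (h 0 0), h⟩

theorem integrable_comp_gaussAvg [ProperSpace E] {g : V → E} (hg : Continuous g)
    (hs : HasCompactSupport g) {Ψ : E → ℝ} (hΨ : ContDiff ℝ 1 Ψ) (h0 : Ψ 0 = 0) (s : ℝ) :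
    Integrable (fun x => Ψ (gaussAvg g s x)) := by
  obtain ⟨R, hR⟩ := exists_norm_gaussAvg_le_const hg hs
  obtain ⟨C, hC⟩ := (isCompact_closedBall (0 : E) R).exists_bound_of_continuousOn
    (hΨ.continuous_fderiv one_ne_zero).continuousOn
  obtain ⟨D, hD⟩ := exists_norm_gaussAvg_le hg hs |s|
  have hR0 : 0 ≤ R := (norm_nonneg _).trans (hR 0 0)
  have hC0 : 0 ≤ C := (norm_nonneg _).trans (hC 0 (by simpa using hR0))
  refine integrable_of_norm_le_polyDecay (C := C * D)
    (hΨ.continuous.comp (continuous_gaussAvg hg hs s)).aestronglyMeasurable fun x => ?_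
  have h := (convex_closedBall (0 : E) R).norm_image_sub_le_of_norm_fderiv_le
    (fun y _ => hΨ.differentiable one_ne_zero y) hC (x := 0) (y := gaussAvg g s x)
    (by simpa using hR0) (by simpa using hR s x)
  rw [h0, sub_zero, sub_zero] at h
  exact h.trans (by rw [mul_assoc]; exact mul_le_mul_of_nonneg_left (hD s le_rfl x) hC0)

variable {ι : Type*} [Fintype ι]

set_option maxHeartbeats 1000000 in
theorem hasDerivAt_integral_comp_gaussAvg [ProperSpace E] (b : OrthonormalBasis ι ℝ V) {g : V → E}
    (hg : ContDiff ℝ 2 g) (hs : HasCompactSupport g) {Ψ : E → ℝ} (hΨ : ContDiff ℝ 2 Ψ)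
    (h0 : Ψ 0 = 0) (s : ℝ) :
    (∀ j, Integrable (fun x => fderiv ℝ (fderiv ℝ Ψ) (gaussAvg g s x)
      (gaussAvg (fun y => fderiv ℝ g y (b j)) s x)
      (gaussAvg (fun y => fderiv ℝ g y (b j)) s x))) ∧
    HasDerivAt (fun s => ∫ x, Ψ (gaussAvg g s x))
      (-(s * ∑ j, ∫ x, fderiv ℝ (fderiv ℝ Ψ) (gaussAvg g s x)
        (gaussAvg (fun y => fderiv ℝ g y (b j)) s x)
        (gaussAvg (fun y => fderiv ℝ g y (b j)) s x))) s := by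
  let g₁ : ι → V → E := fun j y => fderiv ℝ g y (b j)
  let g₂ : ι → V → E := fun j y => fderiv ℝ (g₁ j) y (b j)
  have hc₁ : ∀ j, ContDiff ℝ 1 (g₁ j) := fun j =>
    (hg.fderiv_right (m := 1) (by norm_num)).clm_apply contDiff_const
  have hc₂ : ∀ j, Continuous (g₂ j) := fun j =>
    ((hc₁ j).continuous_fderiv one_ne_zero).clm_apply continuous_const
  have hs₁ : ∀ j, HasCompactSupport (g₁ j) := fun j => hs.fderiv_apply ℝ _
  have hs₂ : ∀ j, HasCompactSupport (g₂ j) := fun j => (hs₁ j).fderiv_apply ℝ _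
  have hΨ' : ContDiff ℝ 1 (fderiv ℝ Ψ) := hΨ.fderiv_right (m := 1) (by norm_num)
  have hΨ'' : Continuous (fderiv ℝ (fderiv ℝ Ψ)) := hΨ'.continuous_fderiv one_ne_zero
  have hΨ'c := hΨ'.continuous
  obtain ⟨C₁, hC₁0, hC₁⟩ := exists_norm_comp_gaussAvg_le hg.continuous hs hΨ'.continuous
  obtain ⟨C₂, hC₂0, hC₂⟩ := exists_norm_comp_gaussAvg_le
    (F := E →L[ℝ] E →L[ℝ] ℝ) hg.continuous hs hΨ''
  choose R hR using fun j => exists_norm_gaussAvg_le_const (hc₁ j).continuous (hs₁ j)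
  choose D₁ hD₁ using fun j => exists_norm_gaussAvg_le (hc₁ j).continuous (hs₁ j) (|s| + 1)
  choose D₂ hD₂ using fun j => exists_norm_gaussAvg_le (hc₂ j) (hs₂ j) (|s| + 1)
  have cw : ∀ s, Continuous (gaussAvg g s) := continuous_gaussAvg hg.continuous hs
  have cw₁ : ∀ j s, Continuous (gaussAvg (g₁ j) s) := fun j =>
    continuous_gaussAvg (hc₁ j).continuous (hs₁ j)
  have cw₂ : ∀ j s, Continuous (gaussAvg (g₂ j) s) := fun j =>
    continuous_gaussAvg (hc₂ j) (hs₂ j)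
  have hsS : |s| ≤ |s| + 1 := by linarith
  -- the dissipation
  have I₂ : ∀ j, Integrable (fun x => fderiv ℝ (fderiv ℝ Ψ) (gaussAvg g s x)
      (gaussAvg (g₁ j) s x) (gaussAvg (g₁ j) s x)) := fun j => by
    refine integrable_of_norm_le_polyDecay (C := C₂ * R j * D₁ j)
      (((hΨ''.comp (cw s)).clm_apply (cw₁ j s)).clm_apply (cw₁ j s)).aestronglyMeasurable
      fun x => ?_
    refine (ContinuousLinearMap.le_opNorm₂ _ _ _).trans ?_
    have h1 := hC₂ s x
    have h2 := hR j s x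
    have h3 := hD₁ j s hsS x
    rw [mul_assoc _ (D₁ j)]
    exact mul_le_mul (mul_le_mul h1 h2 (norm_nonneg _) hC₂0) h3 (norm_nonneg _)
      (mul_nonneg hC₂0 ((norm_nonneg _).trans h2))
  have B₁ : ∀ j r, |r| ≤ |s| + 1 → ∀ x, ‖fderiv ℝ Ψ (gaussAvg g r x) (gaussAvg (g₂ j) r x)‖ ≤
      C₁ * D₂ j * polyDecay x := fun j r hr x => by
    refine (ContinuousLinearMap.le_opNorm _ _).trans ?_
    rw [mul_assoc]
    exact mul_le_mul (hC₁ r x) (hD₂ j r hr x) (norm_nonneg _) hC₁0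
  have I₁ : ∀ j, Integrable (fun x => fderiv ℝ Ψ (gaussAvg g s x) (gaussAvg (g₂ j) s x)) :=
    fun j => integrable_of_norm_le_polyDecay
      ((hΨ'c.comp (cw s)).clm_apply (cw₂ j s)).aestronglyMeasurable (B₁ j s hsS)
  have I₀ : ∀ j, Integrable (fun x => fderiv ℝ Ψ (gaussAvg g s x) (gaussAvg (g₁ j) s x)) :=
    fun j => integrable_of_norm_le_polyDecay (C := C₁ * D₁ j)
      ((hΨ'c.comp (cw s)).clm_apply (cw₁ j s)).aestronglyMeasurable fun x => by
        refine (ContinuousLinearMap.le_opNorm _ _).trans ?_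
        rw [mul_assoc]
        exact mul_le_mul (hC₁ s x) (hD₁ j s hsS x) (norm_nonneg _) hC₁0
  have hparts : ∀ j, ∫ x, fderiv ℝ Ψ (gaussAvg g s x) (gaussAvg (g₂ j) s x) =
      -∫ x, fderiv ℝ (fderiv ℝ Ψ) (gaussAvg g s x)
        (gaussAvg (g₁ j) s x) (gaussAvg (g₁ j) s x) := fun j => by
    have h := integral_eq_zero_of_hasLineDerivAt (v := b j) (I₀ j) ((I₂ j).add (I₁ j))
      fun x => by
        have e0 : HasDerivAt (fun t : ℝ => gaussAvg g s (x + t • b j))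
          (gaussAvg (g₁ j) s x) 0 := hasLineDerivAt_gaussAvg (hg.of_le one_le_two) hs s x (b j)
        have e1 : HasDerivAt (fun t : ℝ => gaussAvg (g₁ j) s (x + t • b j))
          (gaussAvg (g₂ j) s x) 0 := hasLineDerivAt_gaussAvg (hc₁ j) (hs₁ j) s x (b j)
        have e2 := ((hΨ'.differentiable one_ne_zero
          (gaussAvg g s (x + (0 : ℝ) • b j))).hasFDerivAt.comp_hasDerivAt (0 : ℝ) e0).clm_apply e1
        simpa [HasLineDerivAt] using e2
    rw [← add_eq_zero_iff_eq_neg, add_comm, ← integral_add (I₂ j) (I₁ j)]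
    exact h
  refine ⟨I₂, ?_⟩
  have hder := (hasDerivAt_integral_of_dominated_loc_of_deriv_le
    (μ := (volume : Measure V)) (F := fun s x => Ψ (gaussAvg g s x))
    (F' := fun s x => fderiv ℝ Ψ (gaussAvg g s x) (s • ∑ j, gaussAvg (g₂ j) s x))
    (bound := fun x => (|s| + 1) * ∑ j, C₁ * D₂ j * polyDecay x)
    (s := ball s 1) (ball_mem_nhds s one_pos)
    (Filter.Eventually.of_forall fun r =>
      (hΨ.continuous.comp (cw r)).aestronglyMeasurable)
    (integrable_comp_gaussAvg hg.continuous hs (hΨ.of_le one_le_two) h0 s)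
    ((hΨ'c.comp (cw s)).clm_apply
      ((continuous_finsetSum _ fun j _ => cw₂ j s).const_smul s)).aestronglyMeasurable
    (Filter.Eventually.of_forall fun x r hr => ?_)
    ((integrable_finsetSum _ fun j _ => integrable_polyDecay.const_mul _).const_mul _)
    (Filter.Eventually.of_forall fun x r _ =>
      (hΨ.differentiable two_ne_zero _).hasFDerivAt.comp_hasDerivAt r
        (hasDerivAt_gaussAvg b hg hs r x))).2
  · refine hder.congr_deriv ?_
    calc _ = ∫ x, s * ∑ j, fderiv ℝ Ψ (gaussAvg g s x) (gaussAvg (g₂ j) s x) := by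
          simp only [map_smul, map_sum, smul_eq_mul]
      _ = _ := by
          rw [integral_const_mul, integral_finsetSum _ fun j _ => I₁ j]
          simp only [hparts, Finset.sum_neg_distrib, mul_neg]
          rfl
  · have hr' : |r| ≤ |s| + 1 := by
      have h1 := abs_sub_abs_le_abs_sub r s
      rw [mem_ball, Real.dist_eq] at hr
      linarith
    rw [map_smul, map_sum, norm_smul, Real.norm_eq_abs]
    refine mul_le_mul hr' ((norm_sum_le _ _).trans (Finset.sum_le_sum fun j _ => B₁ j r hr' x))
      (norm_nonneg _) (by positivity)

end Entropy

section HeatFlow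

variable {V : Type*} [NormedAddCommGroup V] [InnerProductSpace ℝ V] [FiniteDimensional ℝ V]
  [MeasurableSpace V] [BorelSpace V]

theorem integrable_gaussWeight_smul_comp {E : Type*} [NormedAddCommGroup E] [NormedSpace ℝ E]
    {g : V → E} (hg : Continuous g) (hs : HasCompactSupport g) (s : ℝ) (x : V) :
    Integrable (fun z => gaussWeight z • g (x + s • z)) := by
  obtain ⟨M, hM⟩ := hs.exists_bound_of_continuous hg
  exact integrable_gaussWeight.smul_bdd M (Continuous.aestronglyMeasurable (by fun_prop))
    (Filter.Eventually.of_forall fun z => hM _)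

theorem gaussAvg_prodMk {g h : V → ℝ} (hg : Continuous g) (hgs : HasCompactSupport g)
    (hh : Continuous h) (hhs : HasCompactSupport h) (s : ℝ) (x : V) :
    gaussAvg (fun y => (g y, h y)) s x = (gaussAvg g s x, gaussAvg h s x) := by
  simp only [gaussAvg, Prod.smul_mk]
  exact integral_pair (integrable_gaussWeight_smul_comp hg hgs s x)
    (integrable_gaussWeight_smul_comp hh hhs s x)

theorem gaussAvg_add_sub {f g h : V → ℝ} (hf : Continuous f) (hfs : HasCompactSupport f)
    (hg : Continuous g) (hgs : HasCompactSupport g) (hh : Continuous h)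
    (hhs : HasCompactSupport h) (s : ℝ) (x : V) :
    gaussAvg (fun y => f y + g y - h y) s x =
      gaussAvg f s x + gaussAvg g s x - gaussAvg h s x := by
  have h1 := integrable_gaussWeight_smul_comp hf hfs s x
  have h2 := integrable_gaussWeight_smul_comp hg hgs s x
  have h3 := integrable_gaussWeight_smul_comp hh hhs s x
  simp only [gaussAvg, smul_sub, smul_add]
  rw [← integral_add h1 h2]
  exact integral_sub (h1.add h2) h3

theorem integral_norm_gaussAvg_le {g : V → ℝ} (hg : Continuous g) (hs : HasCompactSupport g)
    (s : ℝ) : ∫ x, ‖gaussAvg g s x‖ ≤ ∫ x, ‖g x‖ := by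
  have hgi : Integrable (fun x => ‖g x‖) := (hg.integrable_of_hasCompactSupport hs).norm
  have hswap : Integrable (Function.uncurry fun x z : V => ‖gaussWeight z • g (x + s • z)‖)
      ((volume : Measure V).prod volume) := by
    rw [integrable_prod_iff' (Continuous.aestronglyMeasurable (by fun_prop))]
    have h1 : ∀ z : V, ∀ x, Function.uncurry (fun x z : V => ‖gaussWeight z • g (x + s • z)‖)
        (x, z) = gaussWeight z * ‖g (x + s • z)‖ := fun z x => by
      simp [abs_of_nonneg (gaussWeight_nonneg z)]
    refine ⟨Filter.Eventually.of_forall fun z => ?_, ?_⟩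
    · simp only [h1]
      exact (hgi.comp_add_right (s • z)).const_mul _
    · simp only [h1, norm_mul, norm_norm, Real.norm_of_nonneg (gaussWeight_nonneg _)]
      simp only [integral_const_mul, integral_add_right_eq_self (fun x => ‖g x‖)]
      exact integrable_gaussWeight.mul_const _
  calc ∫ x, ‖gaussAvg g s x‖ ≤ ∫ x, ∫ z, ‖gaussWeight z • g (x + s • z)‖ := by
        refine integral_mono_of_nonneg (Filter.Eventually.of_forall fun x => norm_nonneg _)
          hswap.integral_prod_left
          (Filter.Eventually.of_forall fun x => norm_integral_le_integral_norm _)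
    _ = ∫ z, ∫ x, ‖gaussWeight z • g (x + s • z)‖ := integral_integral_swap hswap
    _ = ∫ x, ‖g x‖ := by
        simp only [norm_smul, Real.norm_of_nonneg (gaussWeight_nonneg _)]
        simp only [integral_const_mul, integral_add_right_eq_self (fun x => ‖g x‖)]
        rw [integral_mul_const, integral_gaussWeight, one_mul]

theorem norm_gaussAvg_le_of_one_le [Nontrivial V] {g : V → ℝ} (hg : Continuous g)
    (hs : HasCompactSupport g) {s : ℝ} (hs1 : 1 ≤ s) (x : V) :
    ‖gaussAvg g s x‖ ≤ gaussWeight (0 : V) * (∫ x, ‖g x‖) * s⁻¹ := by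
  have hgi : Integrable (fun x => ‖g x‖) := (hg.integrable_of_hasCompactSupport hs).norm
  have hs0 : 0 < s := by linarith
  have hgx : Integrable (fun z => ‖g (x + s • z)‖) :=
    (hgi.comp_add_left x).comp_smul hs0.ne'
  have h1 : ‖gaussAvg g s x‖ ≤ ∫ z, gaussWeight (0 : V) * ‖g (x + s • z)‖ :=
    norm_integral_le_of_norm_le (hgx.const_mul _) (Filter.Eventually.of_forall fun z => by
      rw [norm_smul, Real.norm_of_nonneg (gaussWeight_nonneg z)]
      exact mul_le_mul_of_nonneg_right (gaussWeight_le z) (norm_nonneg _))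
  refine h1.trans ?_
  rw [integral_const_mul, Measure.integral_comp_smul volume (fun z => ‖g (x + z)‖),
    integral_add_left_eq_self (fun z => ‖g z‖), smul_eq_mul, mul_comm |_|, ← mul_assoc]
  have h2 : (0 : ℝ) ≤ ∫ x, ‖g x‖ := integral_nonneg fun x => norm_nonneg _
  have h3 := gaussWeight_nonneg (0 : V)
  refine mul_le_mul_of_nonneg_left ?_ (mul_nonneg h3 h2)
  rw [abs_of_nonneg (by positivity)]
  exact inv_anti₀ hs0 (le_self_pow₀ hs1 Module.finrank_pos.ne')

theorem tendsto_integral_gaussAvg_mul_gaussAvg [Nontrivial V] {f g : V → ℝ} (hf : Continuous f)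
    (hfs : HasCompactSupport f) (hg : Continuous g) (hgs : HasCompactSupport g) :
    Filter.Tendsto (fun s => ∫ x, gaussAvg f s x * gaussAvg g s x) Filter.atTop (nhds 0) := by
  refine squeeze_zero_norm' (a := fun s =>
    gaussWeight (0 : V) * (∫ x, ‖f x‖) * s⁻¹ * ∫ x, ‖g x‖) ?_ ?_
  · filter_upwards [Filter.eventually_ge_atTop 1] with s hs
    have hK : 0 ≤ gaussWeight (0 : V) * (∫ x, ‖f x‖) * s⁻¹ :=
      (norm_nonneg _).trans (norm_gaussAvg_le_of_one_le hf hfs hs 0)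
    obtain ⟨C, hC⟩ := exists_norm_gaussAvg_le hg hgs |s|
    have hi : Integrable (gaussAvg g s) := integrable_of_norm_le_polyDecay
      (continuous_gaussAvg hg hgs s).aestronglyMeasurable (hC s le_rfl)
    refine (norm_integral_le_of_norm_le (hi.norm.const_mul
      (gaussWeight (0 : V) * (∫ x, ‖f x‖) * s⁻¹))
      (Filter.Eventually.of_forall fun x => ?_)).trans ?_
    · rw [norm_mul]
      exact mul_le_mul_of_nonneg_right (norm_gaussAvg_le_of_one_le hf hfs hs x) (norm_nonneg _)
    · rw [integral_const_mul]
      exact mul_le_mul_of_nonneg_left (integral_norm_gaussAvg_le hg hgs s) hK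
  · have := (tendsto_inv_atTop_zero (𝕜 := ℝ)).const_mul (gaussWeight (0 : V) * ∫ x, ‖f x‖)
    simpa using this.mul_const (∫ x, ‖g x‖)

theorem fderiv_fderiv_fst_mul_snd (z d : ℝ × ℝ) :
    fderiv ℝ (fderiv ℝ fun z : ℝ × ℝ => z.1 * z.2) z d d = 2 * (d.1 * d.2) := by
  have h1 : (fderiv ℝ fun z : ℝ × ℝ => z.1 * z.2) =
      ((ContinuousLinearMap.fst ℝ ℝ ℝ).smulRight (ContinuousLinearMap.snd ℝ ℝ ℝ) +
        (ContinuousLinearMap.snd ℝ ℝ ℝ).smulRight (ContinuousLinearMap.fst ℝ ℝ ℝ) :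
          ℝ × ℝ →L[ℝ] ℝ × ℝ →L[ℝ] ℝ) := by
    ext1 w
    have h2 : HasFDerivAt (fun z : ℝ × ℝ => z.1 * z.2) _ w :=
      (hasFDerivAt_fst (𝕜 := ℝ) (p := w)).mul (hasFDerivAt_snd (𝕜 := ℝ) (p := w))
    rw [h2.fderiv]
    ext <;> simp
  rw [h1, ContinuousLinearMap.fderiv]
  simp
  ring

theorem integral_mul_le_of_hessian_bound [Nontrivial V] {ι τ : Type*} [Fintype ι] [Fintype τ]
    (b : OrthonormalBasis ι ℝ V) {κ : ℝ} (hκ : 0 < κ) {Φ : ℝ × ℝ → ℝ} (hΦ : ContDiff ℝ 2 Φ)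
    (hΦ0 : ∀ z, Φ 0 ≤ Φ z)
    (hΦ2 : ∀ z, ∃ A > 0, ∀ d : ℝ × ℝ,
      κ * (A⁻¹ * d.1 ^ 2 + A * d.2 ^ 2) ≤ fderiv ℝ (fderiv ℝ Φ) z d d)
    {f φ : V → ℝ} (hf : ContDiff ℝ 2 f) (hfs : HasCompactSupport f) (hφ : ContDiff ℝ 2 φ)
    (hφs : HasCompactSupport φ) {e : τ → V → ℝ} (he : ∀ a, ContDiff ℝ 2 (e a))
    (hes : ∀ a, HasCompactSupport (e a)) {α₁ α₂ α₃ : ι → τ} {β₁ β₂ β₃ : ι → ι}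
    (hfe : ∀ j x, fderiv ℝ f x (b j) = fderiv ℝ (e (α₁ j)) x (b (β₁ j)) +
      fderiv ℝ (e (α₂ j)) x (b (β₂ j)) - fderiv ℝ (e (α₃ j)) x (b (β₃ j))) :
    ∫ x, f x * φ x ≤ 3 * Fintype.card ι / κ * ∑ a, ∫ x, (Φ (e a x, φ x) - Φ 0) := by
  obtain ⟨C, hC⟩ : ∃ C : ℝ, C = 3 * Fintype.card ι / κ := ⟨_, rfl⟩
  have hC0 : 0 ≤ C := by rw [hC]; positivity
  rw [← hC]
  have cd : ∀ {g : V → ℝ}, ContDiff ℝ 2 g → ∀ v, Continuous fun y => fderiv ℝ g y v :=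
    fun hg v => (hg.continuous_fderiv two_ne_zero).clm_apply continuous_const
  have pair_avg : ∀ {g : V → ℝ}, ContDiff ℝ 2 g → HasCompactSupport g → ∀ s x,
      gaussAvg (fun y => (g y, φ y)) s x = (gaussAvg g s x, gaussAvg φ s x) :=
    fun hg hgs s x => gaussAvg_prodMk hg.continuous hgs hφ.continuous hφs s x
  have pair_avg' : ∀ {g : V → ℝ}, ContDiff ℝ 2 g → HasCompactSupport g → ∀ v s x,
      gaussAvg (fun y => fderiv ℝ (fun y => (g y, φ y)) y v) s x =
        (gaussAvg (fun y => fderiv ℝ g y v) s x, gaussAvg (fun y => fderiv ℝ φ y v) s x) := by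
    intro g hg hgs v s x
    rw [← gaussAvg_prodMk (cd hg v) (hgs.fderiv_apply ℝ v) (cd hφ v) (hφs.fderiv_apply ℝ v)]
    congr 1
    ext1 y
    rw [DifferentiableAt.fderiv_prodMk (hg.differentiable two_ne_zero y)
      (hφ.differentiable two_ne_zero y)]
    rfl
  have pair_supp : ∀ {g : V → ℝ}, HasCompactSupport g →
      HasCompactSupport fun y => (g y, φ y) := by
    intro g hgs
    refine HasCompactSupport.intro (hgs.union hφs) fun x hx => ?_
    simp only [Set.mem_union, not_or] at hx
    rw [image_eq_zero_of_notMem_tsupport hx.1, image_eq_zero_of_notMem_tsupport hx.2]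
    rfl
  let Ψ : ℝ × ℝ → ℝ := fun z => Φ z - Φ 0
  have hΨ : ContDiff ℝ 2 Ψ := hΦ.sub contDiff_const
  have hΨ'' : ∀ z, fderiv ℝ (fderiv ℝ Ψ) z = fderiv ℝ (fderiv ℝ Φ) z := fun z => by
    have : fderiv ℝ Ψ = fderiv ℝ Φ := funext fun w => fderiv_sub_const _
    rw [this]
  have D1 := fun a => hasDerivAt_integral_comp_gaussAvg b ((he a).prodMk hφ) (pair_supp (hes a))
    hΨ (sub_self _)
  have D2 := hasDerivAt_integral_comp_gaussAvg b (hf.prodMk hφ) (pair_supp hfs)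
    (contDiff_fst.mul contDiff_snd : ContDiff ℝ 2 fun z : ℝ × ℝ => z.1 * z.2) (mul_zero _)
  simp only [hΨ'', pair_avg (he _) (hes _), pair_avg' (he _) (hes _)] at D1
  simp only [fderiv_fderiv_fst_mul_snd, pair_avg hf hfs, pair_avg' hf hfs] at D2
  let p : ι → (V → ℝ) → ℝ → V → ℝ := fun j g s x => gaussAvg (fun y => fderiv ℝ g y (b j)) s x
  let Q : τ → ℝ → ι → V → ℝ := fun a s j x => fderiv ℝ (fderiv ℝ Φ)
    (gaussAvg (e a) s x, gaussAvg φ s x) (p j (e a) s x, p j φ s x) (p j (e a) s x, p j φ s x)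
  have hQ : ∀ a s x l m, 2 * κ * (|p l (e a) s x| * |p m φ s x|) ≤ ∑ j, Q a s j x := by
    intro a s x l m
    obtain ⟨A, hA, hAd⟩ := hΦ2 (gaussAvg (e a) s x, gaussAvg φ s x)
    have h1 : κ * (A⁻¹ * p l (e a) s x ^ 2 + A * p m φ s x ^ 2) ≤ ∑ j, Q a s j x := by
      calc κ * (A⁻¹ * p l (e a) s x ^ 2 + A * p m φ s x ^ 2)
          ≤ κ * (A⁻¹ * ∑ j, p j (e a) s x ^ 2 + A * ∑ j, p j φ s x ^ 2) := by
            gcongr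
            · exact Finset.single_le_sum (f := fun j => p j (e a) s x ^ 2)
                (fun j _ => sq_nonneg _) (Finset.mem_univ l)
            · exact Finset.single_le_sum (f := fun j => p j φ s x ^ 2)
                (fun j _ => sq_nonneg _) (Finset.mem_univ m)
        _ = ∑ j, κ * (A⁻¹ * p j (e a) s x ^ 2 + A * p j φ s x ^ 2) := by
            rw [← Finset.mul_sum, Finset.sum_add_distrib, Finset.mul_sum, Finset.mul_sum]
        _ ≤ _ := Finset.sum_le_sum fun j _ => hAd (p j (e a) s x, p j φ s x)
    have h2 : 2 * (|p l (e a) s x| * |p m φ s x|) ≤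
        A⁻¹ * p l (e a) s x ^ 2 + A * p m φ s x ^ 2 := by
      have h3 : A⁻¹ * p l (e a) s x ^ 2 + A * p m φ s x ^ 2 -
          2 * (|p l (e a) s x| * |p m φ s x|) =
          A⁻¹ * (|p l (e a) s x| - A * |p m φ s x|) ^ 2 := by
        rw [← sq_abs (p l (e a) s x), ← sq_abs (p m φ s x)]
        field_simp
        ring
      have h4 : 0 ≤ A⁻¹ * (|p l (e a) s x| - A * |p m φ s x|) ^ 2 := by positivity
      linarith
    nlinarith [mul_le_mul_of_nonneg_left h2 hκ.le]
  have hQ0 : ∀ a s x, 0 ≤ ∑ j, Q a s j x := fun a s x =>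
    Finset.sum_nonneg fun j _ => by
      obtain ⟨A, hA, hAd⟩ := hΦ2 (gaussAvg (e a) s x, gaussAvg φ s x)
      exact (by positivity : (0 : ℝ) ≤ _).trans (hAd _)
  have hpf : ∀ j s x, p j f s x = p (β₁ j) (e (α₁ j)) s x + p (β₂ j) (e (α₂ j)) s x -
      p (β₃ j) (e (α₃ j)) s x := fun j s x => by
    simp only [p]
    rw [← gaussAvg_add_sub (cd (he _) _) ((hes _).fderiv_apply ℝ _) (cd (he _) _)
      ((hes _).fderiv_apply ℝ _) (cd (he _) _) ((hes _).fderiv_apply ℝ _)]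
    simp only [hfe]
  have hpt : ∀ s x, ∑ j, 2 * (p j f s x * p j φ s x) ≤ C * ∑ a, ∑ j, Q a s j x := by
    intro s x
    have hT : ∀ a, ∑ j, Q a s j x ≤ ∑ a, ∑ j, Q a s j x := fun a =>
      Finset.single_le_sum (f := fun a => ∑ j, Q a s j x) (fun a _ => hQ0 a s x)
        (Finset.mem_univ a)
    have h1 : ∀ j, 2 * (p j f s x * p j φ s x) ≤ 3 / κ * ∑ a, ∑ j, Q a s j x := by
      intro j
      have k1 := (hQ (α₁ j) s x (β₁ j) j).trans (hT _)
      have k2 := (hQ (α₂ j) s x (β₂ j) j).trans (hT _)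
      have k3 := (hQ (α₃ j) s x (β₃ j) j).trans (hT _)
      have l1 := le_abs_self (p (β₁ j) (e (α₁ j)) s x * p j φ s x)
      have l2 := le_abs_self (p (β₂ j) (e (α₂ j)) s x * p j φ s x)
      have l3 := neg_abs_le (p (β₃ j) (e (α₃ j)) s x * p j φ s x)
      rw [abs_mul] at l1 l2 l3
      have : 2 * (p j f s x * p j φ s x) * κ ≤ 3 * ∑ a, ∑ j, Q a s j x := by
        rw [hpf]
        nlinarith
      rw [div_mul_eq_mul_div, le_div_iff₀ hκ]
      exact this
    refine (Finset.sum_le_sum fun j _ => h1 j).trans (le_of_eq ?_)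
    rw [Finset.sum_const, Finset.card_univ, nsmul_eq_mul, hC]
    ring
  let H : ℝ → ℝ := fun s => C * (∑ a, ∫ x, Ψ (gaussAvg (e a) s x, gaussAvg φ s x)) -
    ∫ x, gaussAvg f s x * gaussAvg φ s x
  have hH : ∀ s, HasDerivAt H (C * ∑ a, -(s * ∑ j, ∫ x, Q a s j x) -
      -(s * ∑ j, ∫ x, 2 * (p j f s x * p j φ s x))) s := fun s => by
    have d1 := (HasDerivAt.fun_sum (u := Finset.univ) fun a _ => (D1 a s).2).const_mul C
    exact d1.sub (D2 s).2
  have hanti : AntitoneOn H (Set.Ici 0) := by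
    refine antitoneOn_of_deriv_nonpos (convex_Ici 0)
      (fun s _ => (hH s).continuousAt.continuousWithinAt)
      (fun s _ => (hH s).differentiableAt.differentiableWithinAt) fun s hs => ?_
    rw [interior_Ici] at hs
    have hs0 : 0 < s := hs
    rw [(hH s).deriv]
    have i1 : ∀ a j, Integrable (Q a s j) := fun a j => (D1 a s).1 j
    have i2 : ∀ j, Integrable fun x => 2 * (p j f s x * p j φ s x) := fun j => (D2 s).1 j
    have h1 : ∑ j, ∫ x, 2 * (p j f s x * p j φ s x) ≤ C * ∑ a, ∑ j, ∫ x, Q a s j x := by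
      rw [← integral_finsetSum _ fun j _ => i2 j]
      simp only [← integral_finsetSum _ fun j _ => i1 _ j]
      rw [← integral_finsetSum _ fun a _ => integrable_finsetSum _ fun j _ => i1 a j,
        ← integral_const_mul]
      exact integral_mono (integrable_finsetSum _ fun j _ => i2 j)
        ((integrable_finsetSum _ fun a _ => integrable_finsetSum _ fun j _ => i1 a j).const_mul C)
        (hpt s)
    rw [Finset.sum_neg_distrib, ← Finset.mul_sum]
    nlinarith
  have hlow : ∀ s, -∫ x, gaussAvg f s x * gaussAvg φ s x ≤ H s := fun s => by
    have : 0 ≤ C * ∑ a, ∫ x, Ψ (gaussAvg (e a) s x, gaussAvg φ s x) :=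
      mul_nonneg hC0 (Finset.sum_nonneg fun a _ => integral_nonneg fun x =>
        sub_nonneg.2 (hΦ0 _))
    simp only [H]
    linarith
  have hlim : (-0 : ℝ) ≤ H 0 := by
    refine le_of_tendsto (tendsto_integral_gaussAvg_mul_gaussAvg hf.continuous hfs
      hφ.continuous hφs).neg ?_
    filter_upwards [Filter.eventually_ge_atTop 0] with s hs
    exact (hlow s).trans (hanti (Set.mem_Ici.2 le_rfl) (Set.mem_Ici.2 hs) hs)
  simp only [H, gaussAvg_zero, Ψ, neg_zero] at hlim
  linarith

end HeatFlow

section Duality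

theorem le_of_forall_pos_le_add_rpow {A B K L r t : ℝ} (hr : 0 < r) (ht : 0 < t)
    (h : ∀ ε > 0, A ≤ B + K * ε ^ r + L * ε ^ t) : A ≤ B := by
  have hlim : Filter.Tendsto (fun ε : ℝ => B + K * ε ^ r + L * ε ^ t) (nhdsWithin 0 (Set.Ioi 0))
      (nhds (B + K * 0 ^ r + L * 0 ^ t)) := by
    refine Filter.Tendsto.mono_left ?_ nhdsWithin_le_nhds
    exact ((tendsto_const_nhds.add
      ((Real.continuousAt_rpow_const _ _ (Or.inr hr.le)).tendsto.const_mul K)).add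
      ((Real.continuousAt_rpow_const _ _ (Or.inr ht.le)).tendsto.const_mul L))
  rw [Real.zero_rpow hr.ne', Real.zero_rpow ht.ne', mul_zero, mul_zero, add_zero, add_zero] at hlim
  refine ge_of_tendsto hlim ?_
  filter_upwards [self_mem_nhdsWithin] with ε hε
  exact h ε hε

theorem add_rpow_le_two_rpow_mul {a b r : ℝ} (ha : 0 ≤ a) (hb : 0 ≤ b) (hr : 0 ≤ r) :
    (a + b) ^ r ≤ 2 ^ r * (a ^ r + b ^ r) := by
  have ha' := Real.rpow_nonneg ha r
  have hb' := Real.rpow_nonneg hb r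
  rcases le_total a b with h | h
  · calc (a + b) ^ r ≤ (2 * b) ^ r := by gcongr; linarith
      _ = 2 ^ r * b ^ r := Real.mul_rpow zero_le_two hb
      _ ≤ _ := by gcongr; linarith
  · calc (a + b) ^ r ≤ (2 * a) ^ r := by gcongr; linarith
      _ = 2 ^ r * a ^ r := Real.mul_rpow zero_le_two ha
      _ ≤ _ := by gcongr; linarith

theorem sq_rpow_half (x r : ℝ) : (x ^ 2) ^ (r / 2) = |x| ^ r := by
  rw [← sq_abs, ← Real.rpow_natCast, ← Real.rpow_mul (abs_nonneg x)]
  congr 1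
  push_cast
  ring

theorem abs_rpow_sub_le_mul_self {p x ε : ℝ} (hp : 0 ≤ p) (hp₂ : p < 2) (hε : 0 < ε) :
    |x| ^ p - ε ^ (p / 2) ≤ x * (x * (x ^ 2 + ε) ^ (p / 2 - 1)) := by
  have hX : 0 < x ^ 2 + ε := by positivity
  have h1 : (x ^ 2 + ε) ^ (p / 2) = (x ^ 2 + ε) * (x ^ 2 + ε) ^ (p / 2 - 1) := by
    rw [Real.rpow_sub_one hX.ne', mul_div_cancel₀ _ hX.ne']
  have h2 : ε ^ (p / 2) = ε * ε ^ (p / 2 - 1) := by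
    rw [Real.rpow_sub_one hε.ne', mul_div_cancel₀ _ hε.ne']
  have h3 : |x| ^ p ≤ (x ^ 2 + ε) ^ (p / 2) := by
    rw [← sq_rpow_half]
    gcongr
    linarith
  have h4 : (x ^ 2 + ε) ^ (p / 2 - 1) ≤ ε ^ (p / 2 - 1) :=
    Real.rpow_le_rpow_of_nonpos hε (by nlinarith [sq_nonneg x]) (by linarith)
  have h5 := mul_le_mul_of_nonneg_left h4 hε.le
  nlinarith

theorem abs_mul_rpow_le {p q x ε : ℝ} (hp₁ : 1 < p) (hp₂ : p < 2) (hq : q = p / (p - 1))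
    (hε : 0 < ε) : |x * (x ^ 2 + ε) ^ (p / 2 - 1)| ^ q ≤ |x| ^ p := by
  have hp1 : 0 < p - 1 := by linarith
  have hq0 : 0 < q := by rw [hq]; positivity
  rcases eq_or_ne x 0 with rfl | hx
  · simp [Real.zero_rpow hq0.ne', Real.zero_rpow (by linarith : p ≠ 0)]
  · have hx' : 0 < |x| := abs_pos.2 hx
    have h1 : (x ^ 2 + ε) ^ (p / 2 - 1) ≤ |x| ^ (p - 2) := by
      rw [← sq_rpow_half, show (p - 2) / 2 = p / 2 - 1 by ring]
      exact Real.rpow_le_rpow_of_nonpos (by positivity) (by linarith) (by linarith)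
    have h2 : 0 ≤ (x ^ 2 + ε) ^ (p / 2 - 1) := by positivity
    rw [abs_mul, abs_of_nonneg h2]
    calc (|x| * (x ^ 2 + ε) ^ (p / 2 - 1)) ^ q ≤ (|x| * |x| ^ (p - 2)) ^ q := by gcongr
      _ = (|x| ^ (p - 1)) ^ q := by
          rw [mul_comm, ← Real.rpow_add_one hx'.ne', show p - 2 + 1 = p - 1 by ring]
      _ = |x| ^ p := by
          rw [← Real.rpow_mul hx'.le, hq, mul_div_cancel₀ _ hp1.ne']

variable {V : Type*} [NormedAddCommGroup V] [InnerProductSpace ℝ V] [FiniteDimensional ℝ V]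
  [MeasurableSpace V] [BorelSpace V]

theorem integrable_abs_rpow {g : V → ℝ} (hg : Continuous g) (hs : HasCompactSupport g) {r : ℝ}
    (hr : 0 < r) : Integrable (fun x => |g x| ^ r) := by
  refine Continuous.integrable_of_hasCompactSupport
    (hg.abs.rpow_const fun _ => Or.inr hr.le) (hs.comp_left (g := fun y : ℝ => |y| ^ r) ?_)
  simp [Real.zero_rpow hr.ne']

variable [Nontrivial V] {ι τ : Type*} [Fintype ι] [Fintype τ]

theorem exists_integral_mul_le (b : OrthonormalBasis ι ℝ V) {p q : ℝ} (hp₁ : 1 < p) (hp₂ : p < 2)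
    (hq : q = p / (p - 1)) : ∃ C, 0 ≤ C ∧ ∀ {f φ : V → ℝ}, ContDiff ℝ 2 f → HasCompactSupport f →
      ContDiff ℝ 2 φ → HasCompactSupport φ → ∀ {e : τ → V → ℝ}, (∀ a, ContDiff ℝ 2 (e a)) →
      (∀ a, HasCompactSupport (e a)) → ∀ {α₁ α₂ α₃ : ι → τ} {β₁ β₂ β₃ : ι → ι},
      (∀ j x, fderiv ℝ f x (b j) = fderiv ℝ (e (α₁ j)) x (b (β₁ j)) +
        fderiv ℝ (e (α₂ j)) x (b (β₂ j)) - fderiv ℝ (e (α₃ j)) x (b (β₃ j))) →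
      ∫ x, f x * φ x ≤ C * ((∑ a, ∫ x, |e a x| ^ p) + ∫ x, |φ x| ^ q) := by
  have hp0 : 0 < p := by linarith
  have hp1 : 0 < p - 1 := by linarith
  have hq0 : 0 < q := by rw [hq]; positivity
  obtain ⟨κ, hκ, hΦ⟩ := bellman_function hp₁ hp₂ hq
  have h2q : (1 : ℝ) ≤ 2 ^ (q / 2) := Real.one_le_rpow one_le_two (by positivity)
  refine ⟨3 * Fintype.card ι / κ * (2 * 2 ^ (q / 2) * (Fintype.card τ + 1)), by positivity, ?_⟩
  intro f φ hf hfs hφ hφs e he hes α₁ α₂ α₃ β₁ β₂ β₃ hfe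
  let K : τ → Set V := fun a => tsupport (e a) ∪ tsupport φ
  have hK : ∀ a, IsCompact (K a) := fun a => (hes a).isCompact.union hφs.isCompact
  have hKm : ∀ a, MeasurableSet (K a) := fun a => (hK a).measurableSet
  have iφ := integrable_abs_rpow hφ.continuous hφs hq0
  have ie := fun a => integrable_abs_rpow (he a).continuous (hes a) hp0
  obtain ⟨D, hD⟩ : ∃ D : ℝ, D = 2 * 2 ^ (q / 2) := ⟨_, rfl⟩
  have hD0 : 0 ≤ D := by rw [hD]; positivity
  have hD2 : 2 ≤ D := by rw [hD]; linarith
  have main : ∀ ε > 0, ∫ x, f x * φ x ≤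
      3 * Fintype.card ι / κ * (D * ((∑ a, ∫ x, |e a x| ^ p) +
        Fintype.card τ * ∫ x, |φ x| ^ q)) +
      (3 * Fintype.card ι / κ * (D * ∑ a, volume.real (K a))) * ε ^ (p / 2) +
      (3 * Fintype.card ι / κ * (D * ∑ a, volume.real (K a))) * ε ^ (q / 2) := by
    intro ε hε
    obtain ⟨Φ, hΦc, hΦ0, hΦn, hΦu, hΦh⟩ := hΦ ε hε
    refine (integral_mul_le_of_hessian_bound b hκ hΦc hΦ0 hΦh hf hfs hφ hφs he hes hfe).trans ?_
    have hb : ∀ a, ∫ x, (Φ (e a x, φ x) - Φ 0) ≤ D * ((∫ x, |e a x| ^ p) + ∫ x, |φ x| ^ q) +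
        volume.real (K a) * (D * (ε ^ (p / 2) + ε ^ (q / 2))) := by
      intro a
      have hind : Integrable ((K a).indicator fun _ => D * (ε ^ (p / 2) + ε ^ (q / 2))) :=
        (integrable_indicator_iff (hKm a)).2
          (integrableOn_const (hK a).measure_lt_top.ne)
      have hsum : Integrable (fun x => D * (|e a x| ^ p + |φ x| ^ q)) :=
        ((ie a).add iφ).const_mul D
      have hmono : ∫ x, (Φ (e a x, φ x) - Φ 0) ≤ ∫ x, (D * (|e a x| ^ p + |φ x| ^ q) +
          (K a).indicator (fun _ => D * (ε ^ (p / 2) + ε ^ (q / 2))) x) := by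
        refine integral_mono_of_nonneg (Filter.Eventually.of_forall fun x => sub_nonneg.2 (hΦ0 _))
          (hsum.add hind) (Filter.Eventually.of_forall fun x => ?_)
        by_cases hx : x ∈ K a
        · simp only [Set.indicator_of_mem hx]
          have h1 := hΦu (e a x, φ x)
          have h2 : (e a x ^ 2 + ε) ^ (p / 2) ≤ |e a x| ^ p + ε ^ (p / 2) := by
            rw [← sq_rpow_half]
            exact Real.rpow_add_le_add_rpow (sq_nonneg _) hε.le (by positivity) (by linarith)
          have h3 : (φ x ^ 2 + ε) ^ (q / 2) ≤ 2 ^ (q / 2) * (|φ x| ^ q + ε ^ (q / 2)) := by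
            rw [← sq_rpow_half]
            exact add_rpow_le_two_rpow_mul (sq_nonneg _) hε.le (by positivity)
          have h4 : 0 ≤ |e a x| ^ p + ε ^ (p / 2) := by positivity
          simp only at h1
          have h5 : 2 * (|e a x| ^ p + ε ^ (p / 2)) ≤ D * (|e a x| ^ p + ε ^ (p / 2)) := by gcongr
          have h6 : 2 * (2 ^ (q / 2) * (|φ x| ^ q + ε ^ (q / 2))) =
            D * (|φ x| ^ q + ε ^ (q / 2)) := by rw [hD]; ring
          linarith
        · simp only [Set.indicator_of_notMem hx, add_zero]
          simp only [K, Set.mem_union, not_or] at hx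
          rw [image_eq_zero_of_notMem_tsupport hx.1, image_eq_zero_of_notMem_tsupport hx.2]
          rw [show ((0 : ℝ), (0 : ℝ)) = 0 from rfl, sub_self]
          positivity
      refine hmono.trans (le_of_eq ?_)
      rw [integral_add hsum hind, integral_const_mul,
        integral_add (ie a) iφ, integral_indicator_const _ (hKm a), smul_eq_mul]
    refine (mul_le_mul_of_nonneg_left (Finset.sum_le_sum fun a _ => hb a)
      (by positivity)).trans (le_of_eq ?_)
    rw [Finset.sum_add_distrib, ← Finset.mul_sum, Finset.sum_add_distrib, ← Finset.sum_mul,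
      Finset.sum_const, Finset.card_univ, nsmul_eq_mul]
    ring
  refine (le_of_forall_pos_le_add_rpow (by positivity) (by positivity) main).trans ?_
  rw [← hD, mul_assoc, mul_assoc]
  refine mul_le_mul_of_nonneg_left (mul_le_mul_of_nonneg_left ?_ hD0) (by positivity)
  have h1 : 0 ≤ ∑ a, ∫ x, |e a x| ^ p :=
    Finset.sum_nonneg fun a _ => integral_nonneg fun x => by positivity
  have h2 : 0 ≤ ∫ x, |φ x| ^ q := integral_nonneg fun x => by positivity
  have h3 : (0 : ℝ) ≤ Fintype.card τ := by positivity
  nlinarith [mul_nonneg h3 h1]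

theorem exists_integral_abs_rpow_le (b : OrthonormalBasis ι ℝ V) {p : ℝ} (hp₁ : 1 < p)
    (hp₂ : p < 2) : ∃ C, 0 ≤ C ∧ ∀ {f : V → ℝ}, ContDiff ℝ 2 f → HasCompactSupport f →
      ∀ {e : τ → V → ℝ}, (∀ a, ContDiff ℝ 2 (e a)) →
      (∀ a, HasCompactSupport (e a)) → ∀ {α₁ α₂ α₃ : ι → τ} {β₁ β₂ β₃ : ι → ι},
      (∀ j x, fderiv ℝ f x (b j) = fderiv ℝ (e (α₁ j)) x (b (β₁ j)) +
        fderiv ℝ (e (α₂ j)) x (b (β₂ j)) - fderiv ℝ (e (α₃ j)) x (b (β₃ j))) →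
      ∫ x, |f x| ^ p ≤ C * ∑ a, ∫ x, |e a x| ^ p := by
  have hp0 : 0 < p := by linarith
  have hp1 : 0 < p - 1 := by linarith
  obtain ⟨q, hq⟩ : ∃ q, q = p / (p - 1) := ⟨_, rfl⟩
  have hq1 : 1 < q := by rw [hq, lt_div_iff₀ hp1]; linarith
  have hq0 : 0 < q := by linarith
  obtain ⟨C, hC, hmain⟩ := exists_integral_mul_le (τ := τ) b hp₁ hp₂ hq
  -- the scaling of the dual function
  obtain ⟨μ, hμ⟩ : ∃ μ : ℝ, μ = ((2 * C + 1)⁻¹) ^ (1 / (q - 1)) := ⟨_, rfl⟩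
  have hμ0 : 0 < μ := by rw [hμ]; positivity
  have hμq : C * μ ^ q ≤ μ / 2 := by
    have h1 : μ ^ (q - 1) = (2 * C + 1)⁻¹ := by
      rw [hμ, ← Real.rpow_mul (by positivity), one_div_mul_cancel (by linarith), Real.rpow_one]
    have h2 : μ ^ q = μ ^ (q - 1) * μ := by
      rw [← Real.rpow_add_one hμ0.ne', sub_add_cancel]
    rw [h2, h1, ← mul_assoc, ← div_eq_mul_inv, div_mul_eq_mul_div, div_le_div_iff₀
      (by positivity) two_pos]
    nlinarith
  refine ⟨2 * C / μ, by positivity, ?_⟩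
  intro f hf hfs e he hes α₁ α₂ α₃ β₁ β₂ β₃ hfe
  have iF := integrable_abs_rpow hf.continuous hfs hp0
  have hK : IsCompact (tsupport f) := hfs
  have hKm : MeasurableSet (tsupport f) := hK.measurableSet
  have main : ∀ ε > 0, μ * ∫ x, |f x| ^ p ≤
      C * (∑ a, ∫ x, |e a x| ^ p) + μ / 2 * (∫ x, |f x| ^ p) +
        (μ * volume.real (tsupport f)) * ε ^ (p / 2) + 0 * ε ^ (1 : ℝ) := by
    intro ε hε
    have hX : ∀ x, 0 < f x ^ 2 + ε := fun x => by positivity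
    let φ : V → ℝ := fun x => μ * (f x * (f x ^ 2 + ε) ^ (p / 2 - 1))
    have hφ : ContDiff ℝ 2 φ := contDiff_const.mul (hf.mul
      (((hf.pow 2).add contDiff_const).rpow_const_of_ne fun x => (hX x).ne'))
    have hφs : HasCompactSupport φ := by
      refine HasCompactSupport.intro hK fun x hx => ?_
      simp [φ, image_eq_zero_of_notMem_tsupport hx]
    have h1 := hmain hf hfs hφ hφs he hes hfe
    have h2 : ∫ x, |φ x| ^ q ≤ μ ^ q * ∫ x, |f x| ^ p := by
      rw [← integral_const_mul]
      refine integral_mono (integrable_abs_rpow hφ.continuous hφs hq0) (iF.const_mul _) fun x => ?_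
      simp only [φ]
      rw [abs_mul, abs_of_pos hμ0, Real.mul_rpow hμ0.le (abs_nonneg _)]
      exact mul_le_mul_of_nonneg_left (abs_mul_rpow_le hp₁ hp₂ hq hε) (by positivity)
    have hind : Integrable ((tsupport f).indicator fun _ => ε ^ (p / 2)) :=
      (integrable_indicator_iff hKm).2 (integrableOn_const hK.measure_lt_top.ne)
    have h3 : μ * ((∫ x, |f x| ^ p) - volume.real (tsupport f) * ε ^ (p / 2)) ≤
        ∫ x, f x * φ x := by
      have : (∫ x, |f x| ^ p) - volume.real (tsupport f) * ε ^ (p / 2) =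
          ∫ x, (|f x| ^ p - (tsupport f).indicator (fun _ => ε ^ (p / 2)) x) := by
        rw [integral_sub iF hind, integral_indicator_const _ hKm, smul_eq_mul]
      rw [this, ← integral_const_mul]
      refine integral_mono ((iF.sub hind).const_mul _)
        ((hf.continuous.mul hφ.continuous).integrable_of_hasCompactSupport hfs.mul_right)
        fun x => ?_
      simp only [φ]
      rw [mul_left_comm]
      refine mul_le_mul_of_nonneg_left ?_ hμ0.le
      by_cases hx : x ∈ tsupport f
      · rw [Set.indicator_of_mem hx]
        exact abs_rpow_sub_le_mul_self hp0.le hp₂ hε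
      · rw [Set.indicator_of_notMem hx, image_eq_zero_of_notMem_tsupport hx]
        simp [Real.zero_rpow hp0.ne']
    have h4 : 0 ≤ ∫ x, |f x| ^ p := integral_nonneg fun x => by positivity
    have h5 := mul_le_mul_of_nonneg_left h2 hC
    have h6 := mul_le_mul_of_nonneg_right hμq h4
    linarith
  have h := le_of_forall_pos_le_add_rpow (by positivity) one_pos main
  rw [div_mul_eq_mul_div, le_div_iff₀ hμ0]
  linarith

end Duality

theorem abs_entry_le_frob {n : ℕ} (M : Matrix (Fin n) (Fin n) ℝ) (a b : Fin n) :
    |M a b| ≤ frob M := by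
  refine Real.abs_le_sqrt ?_
  refine le_trans ?_ (Finset.single_le_sum (f := fun i => ∑ j, M i j ^ 2)
    (fun i _ => Finset.sum_nonneg fun j _ => sq_nonneg _) (Finset.mem_univ a))
  exact Finset.single_le_sum (f := fun j => M a j ^ 2) (fun j _ => sq_nonneg _)
    (Finset.mem_univ b)

theorem frob_rpow_le {n : ℕ} (M : Matrix (Fin n) (Fin n) ℝ) {p : ℝ} (hp : 1 ≤ p) :
    frob M ^ p ≤ (Fintype.card (Fin n × Fin n) : ℝ) ^ (p - 1) *
      ∑ a : Fin n × Fin n, |M a.1 a.2| ^ p := by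
  have h1 : frob M ≤ ∑ a : Fin n × Fin n, |M a.1 a.2| := by
    refine Real.sqrt_le_iff.2 ⟨Finset.sum_nonneg fun a _ => abs_nonneg _, ?_⟩
    rw [← Fintype.sum_prod_type' (f := fun i j => M i j ^ 2)]
    simp only [← sq_abs (M _ _)]
    exact Finset.sum_sq_le_sq_sum_of_nonneg fun a _ => abs_nonneg _
  refine (Real.rpow_le_rpow (Real.sqrt_nonneg _) h1 (by linarith)).trans ?_
  exact Real.rpow_sum_le_const_mul_sum_rpow Finset.univ _ hp

section Entries

variable {n : ℕ} {u : EuclideanSpace ℝ (Fin n) → EuclideanSpace ℝ (Fin n)}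

theorem contDiff_jacobian (hu : ContDiff ℝ (⊤ : ℕ∞) u) (i k : Fin n) :
    ContDiff ℝ 2 fun x => jacobian u x i k := by
  have h : ContDiff ℝ 2 fun x => fderiv ℝ u x (EuclideanSpace.single k 1) :=
    ((contDiff_infty.1 hu 3).fderiv_right (m := 2) (by norm_num)).clm_apply contDiff_const
  exact (contDiff_piLp 2).1 h i

theorem contDiff_symGrad (hu : ContDiff ℝ (⊤ : ℕ∞) u) (i k : Fin n) :
    ContDiff ℝ 2 fun x => symGrad u x i k :=
  ((contDiff_jacobian hu i k).add (contDiff_jacobian hu k i)).div_const 2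

theorem jacobian_eq_zero {x : EuclideanSpace ℝ (Fin n)} (hx : x ∉ tsupport u) :
    jacobian u x = 0 := by
  ext i k
  have : fderiv ℝ u x = 0 := by
    by_contra h
    exact hx (support_fderiv_subset ℝ h)
  simp [jacobian, this]

theorem symGrad_eq_zero {x : EuclideanSpace ℝ (Fin n)} (hx : x ∉ tsupport u) :
    symGrad u x = 0 := by
  ext i k
  simp [symGrad, jacobian_eq_zero hx]

theorem fderiv_jacobian (hu : ContDiff ℝ (⊤ : ℕ∞) u) (i k : Fin n)
    (x v : EuclideanSpace ℝ (Fin n)) :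
    fderiv ℝ (fun y => jacobian u y i k) x v =
      fderiv ℝ (fderiv ℝ u) x v (EuclideanSpace.single k 1) i := by
  have h1 : HasFDerivAt (fderiv ℝ u) (fderiv ℝ (fderiv ℝ u) x) x :=
    (((contDiff_infty.1 hu 2).fderiv_right (m := 1) (by norm_num)).differentiable
      one_ne_zero x).hasFDerivAt
  have h2 := (EuclideanSpace.proj (𝕜 := ℝ) i).hasFDerivAt.comp x
    (h1.clm_apply (hasFDerivAt_const (EuclideanSpace.single k (1 : ℝ)) x))
  have h3 : HasFDerivAt (fun y => jacobian u y i k) _ x := h2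
  rw [h3.fderiv]
  simp

theorem fderiv_jacobian_comm (hu : ContDiff ℝ (⊤ : ℕ∞) u) (i j k : Fin n)
    (x : EuclideanSpace ℝ (Fin n)) :
    fderiv ℝ (fun y => jacobian u y i k) x (EuclideanSpace.single j 1) =
      fderiv ℝ (fun y => jacobian u y i j) x (EuclideanSpace.single k 1) := by
  rw [fderiv_jacobian hu, fderiv_jacobian hu]
  have h : IsSymmSndFDerivAt ℝ u x :=
    ((contDiff_infty.1 hu 2).contDiffAt (x := x)).isSymmSndFDerivAt (by simp)
  rw [h.eq]

theorem fderiv_symGrad (hu : ContDiff ℝ (⊤ : ℕ∞) u) (i k : Fin n)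
    (x v : EuclideanSpace ℝ (Fin n)) :
    fderiv ℝ (fun y => symGrad u y i k) x v = (fderiv ℝ (fun y => jacobian u y i k) x v +
      fderiv ℝ (fun y => jacobian u y k i) x v) / 2 := by
  have h1 := ((contDiff_jacobian hu i k).differentiable two_ne_zero x).hasFDerivAt
  have h2 := ((contDiff_jacobian hu k i).differentiable two_ne_zero x).hasFDerivAt
  have h3 : HasFDerivAt (fun y => symGrad u y i k) _ x :=
    ((h1.add h2).mul_const (2⁻¹ : ℝ)).congr_of_eventuallyEq
      (Filter.Eventually.of_forall fun y => by simp [symGrad, div_eq_mul_inv])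
  rw [h3.fderiv]
  simp
  ring

theorem fderiv_jacobian_eq_symGrad (hu : ContDiff ℝ (⊤ : ℕ∞) u) (i j k : Fin n)
    (x : EuclideanSpace ℝ (Fin n)) :
    fderiv ℝ (fun y => jacobian u y i k) x (EuclideanSpace.single j 1) =
      fderiv ℝ (fun y => symGrad u y i k) x (EuclideanSpace.single j 1) +
      fderiv ℝ (fun y => symGrad u y i j) x (EuclideanSpace.single k 1) -
      fderiv ℝ (fun y => symGrad u y j k) x (EuclideanSpace.single i 1) := by
  simp only [fderiv_symGrad hu]
  rw [fderiv_jacobian_comm hu i k j, fderiv_jacobian_comm hu j i k, fderiv_jacobian_comm hu k i j]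
  ring

theorem integrable_frob_rpow {M : EuclideanSpace ℝ (Fin n) → Matrix (Fin n) (Fin n) ℝ}
    (hM : ∀ i j, Continuous fun x => M x i j) (hu : HasCompactSupport u)
    (h0 : ∀ x ∉ tsupport u, M x = 0) {p : ℝ} (hp : 0 < p) :
    Integrable fun x => frob (M x) ^ p := by
  refine Continuous.integrable_of_hasCompactSupport ?_ (HasCompactSupport.intro hu fun x hx => ?_)
  · refine Continuous.rpow_const ?_ fun _ => Or.inr hp.le
    unfold frob
    fun_prop
  · simp [frob, h0 x hx, Real.zero_rpow hp.ne']

end Entries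

/-- **Korn's inequality, zero boundary values.** For `n ≥ 2`, `1 < p < 2`,
there is `c = c(n,p) > 0` such that for every ball `B_ρ(x₀) ⊂ ℝⁿ` and every
`u ∈ C_c^∞(B_ρ(x₀), ℝⁿ)`,
`∫_{B_ρ(x₀)} |Du|^p dx ≤ c ∫_{B_ρ(x₀)} |𝓔u|^p dx`. -/
theorem stmt_6 (n : ℕ) (hn : 2 ≤ n) (p : ℝ) (hp₁ : 1 < p) (hp₂ : p < 2) :
    ∃ c : ℝ, 0 < c ∧
      ∀ (x₀ : EuclideanSpace ℝ (Fin n)) (ρ : ℝ), 0 < ρ →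
      ∀ u : EuclideanSpace ℝ (Fin n) → EuclideanSpace ℝ (Fin n),
        ContDiff ℝ (⊤ : ℕ∞) u → HasCompactSupport u → tsupport u ⊆ ball x₀ ρ →
        (∫ x in ball x₀ ρ, frob (jacobian u x) ^ p) ≤
          c * ∫ x in ball x₀ ρ, frob (symGrad u x) ^ p := by
  have hp0 : 0 < p := by linarith
  have : NeZero n := ⟨by omega⟩
  have : Nontrivial (EuclideanSpace ℝ (Fin n)) := by
    have : Nonempty (Fin n) := ⟨0⟩
    infer_instance
  obtain ⟨C, hC, hmain⟩ := exists_integral_abs_rpow_le (τ := Fin n × Fin n)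
    (EuclideanSpace.basisFun (Fin n) ℝ) hp₁ hp₂
  obtain ⟨N, hN⟩ : ∃ N : ℝ, N = Fintype.card (Fin n × Fin n) := ⟨_, rfl⟩
  have hN0 : 0 ≤ N := by rw [hN]; positivity
  refine ⟨N ^ (p - 1) * (N * (C * N)) + 1, by positivity, fun x₀ ρ _ u hu hus hsub => ?_⟩
  have hcJ : ∀ i k, Continuous fun x => jacobian u x i k := fun i k =>
    (contDiff_jacobian hu i k).continuous
  have hcE : ∀ i k, Continuous fun x => symGrad u x i k := fun i k =>
    (contDiff_symGrad hu i k).continuous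
  have hsJ : ∀ i k, HasCompactSupport fun x => jacobian u x i k := fun i k =>
    HasCompactSupport.intro hus fun x hx => by simp [jacobian_eq_zero hx]
  have hsE : ∀ i k, HasCompactSupport fun x => symGrad u x i k := fun i k =>
    HasCompactSupport.intro hus fun x hx => by simp [symGrad_eq_zero hx]
  have hiJ := integrable_frob_rpow hcJ hus (fun x hx => jacobian_eq_zero hx) hp0
  have hiE := integrable_frob_rpow hcE hus (fun x hx => symGrad_eq_zero hx) hp0
  have hfrob : ∀ M : Matrix (Fin n) (Fin n) ℝ, 0 ≤ frob M ^ p := fun M =>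
    Real.rpow_nonneg (Real.sqrt_nonneg _) p
  have hE : ∫ x in ball x₀ ρ, frob (symGrad u x) ^ p = ∫ x, frob (symGrad u x) ^ p := by
    refine setIntegral_eq_integral_of_forall_compl_eq_zero fun x hx => ?_
    rw [symGrad_eq_zero fun h => hx (hsub h)]
    simp [frob, Real.zero_rpow hp0.ne']
  have hentry : ∑ a : Fin n × Fin n, ∫ x, |symGrad u x a.1 a.2| ^ p ≤
      N * ∫ x, frob (symGrad u x) ^ p := by
    rw [hN, ← nsmul_eq_mul, ← Finset.card_univ]
    refine Finset.sum_le_card_nsmul _ _ _ fun a _ => ?_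
    refine integral_mono (integrable_abs_rpow (hcE _ _) (hsE _ _) hp0) hiE fun x => ?_
    exact Real.rpow_le_rpow (abs_nonneg _) (abs_entry_le_frob _ _ _) hp0.le
  have hcomp : ∀ a : Fin n × Fin n, ∫ x, |jacobian u x a.1 a.2| ^ p ≤
      C * ∑ a : Fin n × Fin n, ∫ x, |symGrad u x a.1 a.2| ^ p := fun ⟨i, k⟩ =>
    hmain (contDiff_jacobian hu i k) (hsJ i k) (e := fun a x => symGrad u x a.1 a.2)
      (fun a => contDiff_symGrad hu _ _) (fun a => hsE _ _)
      (α₁ := fun _ => (i, k)) (α₂ := fun j => (i, j)) (α₃ := fun j => (j, k))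
      (β₁ := fun j => j) (β₂ := fun _ => k) (β₃ := fun _ => i) fun j x => by
        simpa using fderiv_jacobian_eq_symGrad hu i j k x
  have hJ : ∫ x, frob (jacobian u x) ^ p ≤
      N ^ (p - 1) * ∑ a : Fin n × Fin n, ∫ x, |jacobian u x a.1 a.2| ^ p := by
    have hi : ∀ a : Fin n × Fin n, Integrable fun x => |jacobian u x a.1 a.2| ^ p := fun a =>
      integrable_abs_rpow (hcJ _ _) (hsJ _ _) hp0
    rw [← integral_finsetSum _ fun a _ => hi a, ← integral_const_mul]
    refine integral_mono hiJ ((integrable_finsetSum _ fun a _ => hi a).const_mul _) fun x => ?_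
    rw [hN]
    exact frob_rpow_le _ hp₁.le
  have hJsum : ∑ a : Fin n × Fin n, ∫ x, |jacobian u x a.1 a.2| ^ p ≤
      N * (C * (N * ∫ x, frob (symGrad u x) ^ p)) := by
    rw [hN, ← nsmul_eq_mul, ← Finset.card_univ]
    refine Finset.sum_le_card_nsmul _ _ _ fun a _ => (hcomp a).trans ?_
    rw [Finset.card_univ, ← hN]
    exact mul_le_mul_of_nonneg_left hentry hC
  have hE0 : 0 ≤ ∫ x, frob (symGrad u x) ^ p := integral_nonneg fun x => hfrob _
  rw [hE]
  calc ∫ x in ball x₀ ρ, frob (jacobian u x) ^ p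
      ≤ ∫ x, frob (jacobian u x) ^ p :=
        setIntegral_le_integral hiJ (Filter.Eventually.of_forall fun x => hfrob _)
    _ ≤ N ^ (p - 1) * (N * (C * (N * ∫ x, frob (symGrad u x) ^ p))) :=
        hJ.trans (mul_le_mul_of_nonneg_left hJsum (by positivity))
    _ ≤ _ := by
        rw [add_mul, one_mul]
        refine le_add_of_le_of_nonneg (le_of_eq ?_) hE0
        ring
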